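/- Suppose (A1) and (A2) hold and that the mean drift satisfies ‖μ(x)‖ = O(‖x‖^{−1}) as ‖x‖ → ∞ (i.e., there exist C, r₀ ∈ (0,∞) with ‖μ(x)‖ ≤ C/‖x‖ for all x ∈ S with ‖x‖ ≥ r₀). Then for any α ∈ (0,π] and any x ∈ W(α), P[τ_α < ∞ | ξ₀ = x] = 1. -/

import Mathlib

open MeasureTheory
open scoped ENNReal

noncomputable section

/-- Euclidean norm of a lattice point in `ℤ²`. -/
def znorm (x : ℤ × ℤ) : ℝ := Real.sqrt ((x.1 : ℝ) ^ 2 + (x.2 : ℝ) ^ 2)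

/-- Polar angle in `(-π, π]` of a lattice point. -/
def ang (x : ℤ × ℤ) : ℝ := Complex.arg ⟨(x.1 : ℝ), (x.2 : ℝ)⟩

/-- The harmonic function `f_w(x) = r^w cos(w φ)` in polar coordinates. -/
def fw (w : ℝ) (x : ℤ × ℤ) : ℝ := znorm x ^ w * Real.cos (w * ang x)

/-- First component of the mean drift at `x` given jump pmf `p`. -/
def mu1 (p : ℤ × ℤ → ℤ × ℤ → ℝ) (x : ℤ × ℤ) : ℝ := ∑' y : ℤ × ℤ, p x y * (y.1 : ℝ)

/-- Second component of the mean drift at `x`. -/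
def mu2 (p : ℤ × ℤ → ℤ × ℤ → ℝ) (x : ℤ × ℤ) : ℝ := ∑' y : ℤ × ℤ, p x y * (y.2 : ℝ)

/-- Euclidean norm of the mean drift at `x`. -/
def muNorm (p : ℤ × ℤ → ℤ × ℤ → ℝ) (x : ℤ × ℤ) : ℝ :=
  Real.sqrt (mu1 p x ^ 2 + mu2 p x ^ 2)

/-- Second moment `M₁₁(x)`. -/
def M11 (p : ℤ × ℤ → ℤ × ℤ → ℝ) (x : ℤ × ℤ) : ℝ := ∑' y : ℤ × ℤ, p x y * (y.1 : ℝ) ^ 2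

/-- Second moment `M₂₂(x)`. -/
def M22 (p : ℤ × ℤ → ℤ × ℤ → ℝ) (x : ℤ × ℤ) : ℝ := ∑' y : ℤ × ℤ, p x y * (y.2 : ℝ) ^ 2

/-- Mixed second moment `M₁₂(x)`. -/
def M12 (p : ℤ × ℤ → ℤ × ℤ → ℝ) (x : ℤ × ℤ) : ℝ :=
  ∑' y : ℤ × ℤ, p x y * ((y.1 : ℝ) * (y.2 : ℝ))

/-- `p` is a family of probability mass functions on `ℤ²` (the jump laws `θ(x)`). -/
def IsJumpPMF (p : ℤ × ℤ → ℤ × ℤ → ℝ) : Prop :=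
  (∀ x y, 0 ≤ p x y) ∧ ∀ x, HasSum (p x) 1

/-- (A2): jumps are uniformly bounded by `b`: `P[‖θ(x)‖ > b] = 0` for all `x`. -/
def A2 (p : ℤ × ℤ → ℤ × ℤ → ℝ) (b : ℝ) : Prop :=
  ∀ x y, b < znorm y → p x y = 0

section walk

variable {Ω : Type*} [MeasurableSpace Ω]

/-- `ξ` is a time-homogeneous Markov chain with one-step jump law `p`:
conditionally on the past and on `ξ_t = x`, the law of `ξ_{t+1} - ξ_t` is `p x`. -/
def IsMarkovWith (P : Measure Ω) (ξ : ℕ → Ω → ℤ × ℤ) (p : ℤ × ℤ → ℤ × ℤ → ℝ) : Prop :=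
  ∀ (t : ℕ) (x y : ℤ × ℤ) (A : Set Ω),
    MeasurableSet[⨆ s ∈ Finset.range (t + 1), MeasurableSpace.comap (ξ s) ⊤] A →
    P (A ∩ {ω | ξ t ω = x} ∩ {ω | ξ (t + 1) ω = x + y}) =
      ENNReal.ofReal (p x y) * P (A ∩ {ω | ξ t ω = x})

/-- (A1): uniform weak isotropy: from any `x ∈ S`, in `n₀` steps the walk moves by
each of `±k e₁, ±k e₂` with conditional probability at least `κ`. -/
def A1 (P : Measure Ω) (S : Set (ℤ × ℤ)) (ξ : ℕ → Ω → ℤ × ℤ)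
    (κ : ℝ) (k n₀ : ℕ) : Prop :=
  ∀ (t : ℕ), ∀ x ∈ S,
    ∀ y ∈ ({((k : ℤ), (0 : ℤ)), (-(k : ℤ), 0), (0, (k : ℤ)), (0, -(k : ℤ))} : Set (ℤ × ℤ)),
      ENNReal.ofReal κ * P {ω | ξ t ω = x} ≤
        P ({ω | ξ t ω = x} ∩ {ω | ξ (t + n₀) ω = x + y})

/-- First exit time from a region `Wm`, with value `∞` if the walk never leaves. -/
def exitTime (Wm : Set (ℤ × ℤ)) (ξ : ℕ → Ω → ℤ × ℤ) (ω : Ω) : ℝ≥0∞ :=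
  ⨅ (t : ℕ) (_ : ξ t ω ∉ Wm), (t : ℝ≥0∞)

end walk

/-- The wedge `W(α)` for `α ∈ (0,π)`, together with the `α = π` case, where
`W(π) = ℝ² \ H_b` is the complement of the thickened half-line of half-width `b`. -/
def Wset (b α : ℝ) : Set (ℤ × ℤ) :=
  {x | (α < Real.pi ∧ znorm x * Real.cos α < (x.1 : ℝ)) ∨
       (α = Real.pi ∧ ¬ ((x.1 : ℝ) ≤ 0 ∧ |(x.2 : ℝ)| ≤ b))}

/-- The wedge `W(α) = {x : r > 0, -α < φ < α}` in polar form, for `α ∈ (0,π]`. -/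
def WsetArg (α : ℝ) : Set (ℤ × ℤ) :=
  {x | 0 < znorm x ∧ -α < ang x ∧ ang x < α}

end

open Filter Topology

/-- The one-step transition operator of the walk with jump law `p` (supported in `D`), killed on
leaving `V`. -/
noncomputable def killedStep (p : ℤ × ℤ → ℤ × ℤ → ℝ) (D : Finset (ℤ × ℤ)) (V : Set (ℤ × ℤ)) :
    Module.End ℝ (ℤ × ℤ → ℝ) where
  toFun f x := ∑ y ∈ D, p x y * V.indicator f (x + y)
  map_add' f g := by
    funext x
    simp only [Set.indicator_add', Pi.add_apply, mul_add, Finset.sum_add_distrib]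
  map_smul' c f := by
    funext x
    simp only [Pi.smul_apply, smul_eq_mul, RingHom.id_apply, Finset.mul_sum]
    refine Finset.sum_congr rfl fun y _ => ?_
    by_cases h : x + y ∈ V
    · simp only [Set.indicator_of_mem h, Pi.smul_apply, smul_eq_mul]
      ring
    · simp [h]

/-- The jump laws `p x` are probability vectors on the finite set `D`, with jumps of norm at most
`b`. -/
structure IsBoundedJumpLaw (p : ℤ × ℤ → ℤ × ℤ → ℝ) (D : Finset (ℤ × ℤ)) (b : ℝ) : Prop where
  nonneg : ∀ x y, 0 ≤ p x y
  sum_eq_one : ∀ x, ∑ y ∈ D, p x y = 1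
  mem_of_ne_zero : ∀ x y, p x y ≠ 0 → y ∈ D
  znorm_le : ∀ x y, p x y ≠ 0 → znorm y ≤ b

section Operators

variable {p : ℤ × ℤ → ℤ × ℤ → ℝ} {D : Finset (ℤ × ℤ)} {b : ℝ} {V : Set (ℤ × ℤ)}

lemma killedStep_apply (f : ℤ × ℤ → ℝ) (x : ℤ × ℤ) :
    killedStep p D V f x = ∑ y ∈ D, p x y * V.indicator f (x + y) := rfl

lemma killedStep_univ_apply (f : ℤ × ℤ → ℝ) (x : ℤ × ℤ) :
    killedStep p D Set.univ f x = ∑ y ∈ D, p x y * f (x + y) := by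
  simp [killedStep_apply]

lemma killedStep_le (hp : IsBoundedJumpLaw p D b) {V' : Set (ℤ × ℤ)} {f g : ℤ × ℤ → ℝ}
    {x : ℤ × ℤ} (h : ∀ y, p x y ≠ 0 → V.indicator f (x + y) ≤ V'.indicator g (x + y)) :
    killedStep p D V f x ≤ killedStep p D V' g x := by
  refine Finset.sum_le_sum fun y _ => ?_
  by_cases hy : p x y = 0
  · simp [hy]
  · exact mul_le_mul_of_nonneg_left (h y hy) (hp.nonneg x y)

/-- Comparison of iterates along the walk, `A j` being the states allowed after `j` steps. -/
lemma killedStep_pow_le (hp : IsBoundedJumpLaw p D b) {f g : ℤ × ℤ → ℝ}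
    (A : ℕ → ℤ × ℤ → Prop)
    (hA : ∀ j x y, A j x → p x y ≠ 0 → x + y ∈ V → A (j + 1) (x + y)) (n : ℕ) :
    ∀ (j : ℕ) (x : ℤ × ℤ), A j x → (∀ z, A (j + n) z → f z ≤ g z) →
      (killedStep p D V ^ n) f x ≤ (killedStep p D V ^ n) g x := by
  induction n with
  | zero => intro j x hx h; simpa using h x hx
  | succ n ih =>
    intro j x hx h
    rw [pow_succ', Module.End.mul_apply, Module.End.mul_apply]
    refine killedStep_le hp fun y hy => ?_
    by_cases hV : x + y ∈ V
    · rw [Set.indicator_of_mem hV, Set.indicator_of_mem hV]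
      refine ih (j + 1) _ (hA j x y hx hy hV) fun z hz => h z ?_
      rwa [add_right_comm, add_assoc] at hz
    · simp [hV]

lemma killedStep_pow_mono (hp : IsBoundedJumpLaw p D b) {f g : ℤ × ℤ → ℝ}
    {A : Set (ℤ × ℤ)} (hA : ∀ x ∈ A, ∀ y, p x y ≠ 0 → x + y ∈ V → x + y ∈ A)
    (h : ∀ z ∈ A, f z ≤ g z) (n : ℕ) {x : ℤ × ℤ} (hx : x ∈ A) :
    (killedStep p D V ^ n) f x ≤ (killedStep p D V ^ n) g x :=
  killedStep_pow_le hp (fun _ z => z ∈ A) (fun _ x y hx => hA x hx y) n 0 x hx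
    fun z hz => h z hz

lemma killedStep_pow_mono_of_le (hp : IsBoundedJumpLaw p D b) {f g : ℤ × ℤ → ℝ}
    (h : f ≤ g) (n : ℕ) (x : ℤ × ℤ) :
    (killedStep p D V ^ n) f x ≤ (killedStep p D V ^ n) g x :=
  killedStep_pow_mono hp (A := Set.univ) (fun _ _ _ _ _ => trivial) (fun z _ => h z) n
    (Set.mem_univ x)

lemma killedStep_pow_nonneg (hp : IsBoundedJumpLaw p D b) {f : ℤ × ℤ → ℝ}
    (h : 0 ≤ f) (n : ℕ) (x : ℤ × ℤ) : 0 ≤ (killedStep p D V ^ n) f x := by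
  simpa using killedStep_pow_mono_of_le (V := V) hp h n x

lemma killedStep_univ_one (hp : IsBoundedJumpLaw p D b) : killedStep p D Set.univ 1 = 1 := by
  funext x
  simp [killedStep_univ_apply, hp.sum_eq_one]

lemma killedStep_univ_pow_const (hp : IsBoundedJumpLaw p D b) (c : ℝ) (n : ℕ) :
    (killedStep p D Set.univ ^ n) (fun _ => c) = fun _ => c := by
  have h1 : (killedStep p D Set.univ ^ n) 1 = 1 := by
    induction n with
    | zero => simp
    | succ n ih => rw [pow_succ, Module.End.mul_apply, killedStep_univ_one hp, ih]
  have : (fun _ => c : ℤ × ℤ → ℝ) = c • 1 := by funext; simp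
  rw [this, map_smul, h1]

lemma killedStep_one_le (hp : IsBoundedJumpLaw p D b) : killedStep p D V 1 ≤ 1 := by
  intro x
  refine (killedStep_le (V' := Set.univ) (g := 1) hp fun y _ => ?_).trans
    (congrFun (killedStep_univ_one hp) x).le
  by_cases hV : x + y ∈ V <;> simp [hV]

lemma killedStep_pow_one_antitone (hp : IsBoundedJumpLaw p D b) (x : ℤ × ℤ) :
    Antitone fun n => (killedStep p D V ^ n) 1 x := by
  refine antitone_nat_of_succ_le fun n => ?_
  rw [pow_succ, Module.End.mul_apply]
  exact killedStep_pow_mono_of_le hp (killedStep_one_le hp) n x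

lemma killedStep_pow_one_le (hp : IsBoundedJumpLaw p D b) (n : ℕ) (x : ℤ × ℤ) :
    (killedStep p D V ^ n) 1 x ≤ 1 := by
  simpa using killedStep_pow_one_antitone (V := V) hp x (Nat.zero_le n)

end Operators

section Angle

lemma one_add_add_sq_div_four_le_exp {s : ℝ} (hs : |s| ≤ 1) : 1 + s + s ^ 2 / 4 ≤ Real.exp s := by
  have h := Real.exp_bound hs (n := 3) (by norm_num)
  simp only [Finset.sum_range_succ, Finset.sum_range_zero, Nat.factorial] at h
  norm_num at h
  have h3 : |s| ^ 3 ≤ s ^ 2 := by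
    rw [pow_succ, sq_abs]
    exact mul_le_of_le_one_right (sq_nonneg s) hs
  have := (abs_le.1 h).1
  nlinarith

lemma abs_arg_one_add_sub_im_le {w : ℂ} (hw : ‖w‖ ≤ 1 / 2) :
    |Complex.arg (1 + w) - w.im| ≤ ‖w‖ ^ 2 := by
  have h := Complex.norm_log_one_add_sub_self_le (z := w) (by linarith)
  have h2 : (1 - ‖w‖)⁻¹ ≤ 2 := by
    rw [inv_le_comm₀ (by linarith) (by norm_num)]
    linarith
  have h3 := Complex.abs_im_le_norm (Complex.log (1 + w) - w)
  rw [Complex.sub_im, Complex.log_im] at h3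
  nlinarith [sq_nonneg ‖w‖]

lemma le_exp_mul_arg_one_add {l : ℝ} (hl : 0 ≤ l) {w : ℂ} (hw : ‖w‖ ≤ 1 / 2)
    (hlw : 2 * l * ‖w‖ ≤ 1) :
    1 + l * w.im - l * ‖w‖ ^ 2 + l ^ 2 / 8 * w.im ^ 2 - l ^ 2 / 4 * ‖w‖ ^ 4 ≤
      Real.exp (l * Complex.arg (1 + w)) := by
  have h := abs_arg_one_add_sub_im_le hw
  set d := Complex.arg (1 + w) with hd
  have him := Complex.abs_im_le_norm w
  have hn := norm_nonneg w
  have hd2 : |d| ≤ 2 * ‖w‖ := by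
    have : |d| ≤ |d - w.im| + |w.im| := by simpa using abs_add_le (d - w.im) w.im
    nlinarith
  have hs : |l * d| ≤ 1 := by
    rw [abs_mul, abs_of_nonneg hl]
    nlinarith
  refine le_trans ?_ (one_add_add_sq_div_four_le_exp hs)
  have hsq : (d - w.im) ^ 2 ≤ ‖w‖ ^ 4 := by
    rw [← sq_abs]
    calc |d - w.im| ^ 2 ≤ (‖w‖ ^ 2) ^ 2 := by gcongr
      _ = ‖w‖ ^ 4 := by ring
  have h1 : l * (w.im - ‖w‖ ^ 2) ≤ l * d :=
    mul_le_mul_of_nonneg_left (by linarith [(abs_le.1 h).1]) hl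
  have h2 : w.im ^ 2 ≤ 2 * d ^ 2 + 2 * ‖w‖ ^ 4 := by nlinarith [sq_nonneg (2 * d - w.im)]
  have h3 := mul_le_mul_of_nonneg_left h2 (sq_nonneg l)
  nlinarith

lemma abs_arg_div_lt {x z : ℂ} (h : ‖z - x‖ < ‖x‖) : |Complex.arg (z / x)| < Real.pi / 2 := by
  rw [Complex.abs_arg_lt_pi_div_two_iff]
  left
  have hx : x ≠ 0 := by
    rintro rfl
    simp only [sub_zero, norm_zero] at h
    linarith [norm_nonneg z]
  have h1 : ‖z / x - 1‖ < 1 := by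
    rw [div_sub_one hx, norm_div]
    exact (div_lt_one (norm_pos_iff.2 hx)).2 h
  have h2 := (abs_lt.1 ((Complex.abs_re_le_norm _).trans_lt h1)).1
  simp only [Complex.sub_re, Complex.one_re] at h2
  linarith

/-- Away from the strip around the cut, the argument changes continuously along short jumps. -/
lemma arg_eq_arg_add_arg_div {b : ℝ} {z z' : ℂ} (hz : ¬ (z.re ≤ 0 ∧ |z.im| ≤ b))
    (hb : ‖z' - z‖ ≤ b) (hbz : b < ‖z‖) :
    Complex.arg z' = Complex.arg z + Complex.arg (z' / z) := by
  have hzz := abs_lt.1 (abs_arg_div_lt (hb.trans_lt hbz))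
  have hb0 : 0 ≤ b := (norm_nonneg _).trans hb
  have hz0 : z ≠ 0 := norm_pos_iff.1 (hb0.trans_lt hbz)
  have him := (Complex.abs_im_le_norm _).trans hb
  rw [Complex.sub_im] at him
  have him' := abs_le.1 him
  have hz'0 : z' ≠ 0 := by
    rintro rfl
    rw [zero_sub, norm_neg] at hb
    linarith
  by_cases hre : z.re ≤ 0
  · have him0 : b < |z.im| := not_le.1 fun h => hz ⟨hre, h⟩
    have key : Complex.arg z ≠ Real.pi →
        Complex.arg z' - Complex.arg z ∈ Set.Ioc (-Real.pi) Real.pi →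
        Complex.arg z' = Complex.arg z + Complex.arg (z' / z) := by
      intro h1 h2
      have hinv : Complex.arg z⁻¹ = -Complex.arg z := by rw [Complex.arg_inv, if_neg h1]
      rw [div_eq_mul_inv, Complex.arg_mul hz'0 (inv_ne_zero hz0), hinv]
      · ring
      · rwa [hinv, ← sub_eq_add_neg]
    rcases lt_abs.1 him0 with h | h
    · have h1 := Complex.arg_nonneg_iff.2 (show 0 ≤ z.im by linarith)
      have h2 := Complex.arg_nonneg_iff.2 (show 0 ≤ z'.im by linarith)
      have h3 := Complex.arg_lt_pi_iff.2 (show 0 ≤ z.re ∨ z.im ≠ 0 from Or.inr (by linarith))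
      have h4 := Complex.arg_lt_pi_iff.2 (show 0 ≤ z'.re ∨ z'.im ≠ 0 from Or.inr (by linarith))
      exact key h3.ne ⟨by linarith, by linarith⟩
    · have h1 := Complex.arg_neg_iff.2 (show z.im < 0 by linarith)
      have h2 := Complex.arg_neg_iff.2 (show z'.im < 0 by linarith)
      have h3 := Complex.neg_pi_lt_arg z
      have h4 := Complex.neg_pi_lt_arg z'
      have := Real.pi_pos
      exact key (by linarith) ⟨by linarith, by linarith⟩
  · have h1 := abs_lt.1 (Complex.abs_arg_lt_pi_div_two_iff.2 (Or.inl (not_le.1 hre)))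
    rw [← Complex.arg_mul hz0 (div_ne_zero hz'0 hz0) ⟨by linarith, by linarith⟩,
      mul_div_cancel₀ _ hz0]

lemma arg_eq_arg_add_arg_div_trans {x z z' : ℂ} (hx : ‖z - x‖ < ‖x‖) (hz : ‖z' - z‖ < ‖z‖)
    (h1 : Complex.arg z = Complex.arg x + Complex.arg (z / x))
    (h2 : Complex.arg z' = Complex.arg z + Complex.arg (z' / z)) :
    Complex.arg z' = Complex.arg x + Complex.arg (z' / x) := by
  have hx0 : x ≠ 0 := norm_pos_iff.1 ((norm_nonneg _).trans_lt hx)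
  have hz0 : z ≠ 0 := norm_pos_iff.1 ((norm_nonneg _).trans_lt hz)
  have hz'0 : z' ≠ 0 := by
    rintro rfl
    rw [zero_sub, norm_neg] at hz
    exact lt_irrefl _ hz
  have e1 := abs_lt.1 (abs_arg_div_lt hx)
  have e2 := abs_lt.1 (abs_arg_div_lt hz)
  have : z' / x = z / x * (z' / z) := by field_simp
  rw [this, Complex.arg_mul (div_ne_zero hz0 hx0) (div_ne_zero hz'0 hz0)
    ⟨by linarith, by linarith⟩, h2, h1]
  ring

end Angle

/-- A lattice point as a complex number. -/
def latticePoint (x : ℤ × ℤ) : ℂ := ⟨x.1, x.2⟩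

section Lattice

@[simp] lemma latticePoint_re (x : ℤ × ℤ) : (latticePoint x).re = x.1 := rfl

@[simp] lemma latticePoint_im (x : ℤ × ℤ) : (latticePoint x).im = x.2 := rfl

lemma latticePoint_add (x y : ℤ × ℤ) :
    latticePoint (x + y) = latticePoint x + latticePoint y := by
  apply Complex.ext <;> simp

lemma norm_latticePoint (x : ℤ × ℤ) : ‖latticePoint x‖ = znorm x := by
  rw [Complex.norm_def, Complex.normSq_apply, znorm]
  simp only [latticePoint_re, latticePoint_im]
  congr 1
  ring

lemma znorm_nonneg (x : ℤ × ℤ) : 0 ≤ znorm x := Real.sqrt_nonneg _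

lemma znorm_sq (x : ℤ × ℤ) : znorm x ^ 2 = (x.1 : ℝ) ^ 2 + (x.2 : ℝ) ^ 2 :=
  Real.sq_sqrt (by positivity)

lemma abs_fst_le_znorm (x : ℤ × ℤ) : |(x.1 : ℝ)| ≤ znorm x := by
  rw [← norm_latticePoint]
  exact Complex.abs_re_le_norm (latticePoint x)

lemma abs_snd_le_znorm (x : ℤ × ℤ) : |(x.2 : ℝ)| ≤ znorm x := by
  rw [← norm_latticePoint]
  exact Complex.abs_im_le_norm (latticePoint x)

lemma latticePoint_div_im (z x : ℤ × ℤ) :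
    (latticePoint z / latticePoint x).im = (z.2 * x.1 - z.1 * x.2) / znorm x ^ 2 := by
  rw [Complex.div_im, ← norm_latticePoint x, ← Complex.normSq_eq_norm_sq]
  simp only [latticePoint_re, latticePoint_im]
  ring

end Lattice

section Moments

variable {p : ℤ × ℤ → ℤ × ℤ → ℝ} {D : Finset (ℤ × ℤ)} {b : ℝ} {V G : Set (ℤ × ℤ)}

lemma znorm_le_add_of_step (hp : IsBoundedJumpLaw p D b) {x y : ℤ × ℤ} (h : p x y ≠ 0) :
    znorm x ≤ znorm (x + y) + b := by
  have h1 := norm_sub_le (latticePoint (x + y)) (latticePoint y)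
  rw [latticePoint_add, add_sub_cancel_right, ← latticePoint_add] at h1
  simp only [norm_latticePoint] at h1
  linarith [hp.znorm_le x y h]

lemma killedStep_univ_inv_one_add_znorm_le (hp : IsBoundedJumpLaw p D b) (hb : 0 ≤ b)
    (x : ℤ × ℤ) :
    killedStep p D Set.univ (fun z => (1 + znorm z)⁻¹) x ≤ (1 + b) * (1 + znorm x)⁻¹ := by
  have := congrFun (killedStep_univ_pow_const hp ((1 + b) * (1 + znorm x)⁻¹) 1) x
  rw [pow_one] at this
  rw [← this]
  refine killedStep_le hp fun y hy => ?_
  simp only [Set.indicator_univ]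
  have h1 := znorm_le_add_of_step hp hy
  have h2 := znorm_nonneg x
  have h3 := znorm_nonneg (x + y)
  rw [← div_eq_mul_inv, inv_eq_one_div, div_le_div_iff₀ (by linarith) (by linarith)]
  nlinarith

/-- An `O(‖x‖⁻¹)` one-step drift of `h` yields an `O(‖x‖⁻¹)` drift over `n` steps. -/
lemma exists_abs_killedStep_univ_pow_sub_le (hp : IsBoundedJumpLaw p D b) (hb : 0 ≤ b)
    (hG : ∀ x ∈ G, ∀ y, p x y ≠ 0 → x + y ∈ G) {h : ℤ × ℤ → ℝ} {c : ℝ} (hc : 0 ≤ c)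
    (hh : ∀ x ∈ G, |killedStep p D Set.univ h x - h x| ≤ c * (1 + znorm x)⁻¹) (n : ℕ) :
    ∃ c' : ℝ, 0 ≤ c' ∧
      ∀ x ∈ G, |(killedStep p D Set.univ ^ n) h x - h x| ≤ c' * (1 + znorm x)⁻¹ := by
  induction n with
  | zero => exact ⟨0, le_rfl, fun x _ => by simp⟩
  | succ n ih =>
    obtain ⟨c', hc', ih⟩ := ih
    refine ⟨c' * (1 + b) + c, by positivity, fun x hx => ?_⟩
    set Q := killedStep p D Set.univ with hQ
    have e : (Q ^ (n + 1)) h x - h x = Q ((Q ^ n) h - h) x + (Q h x - h x) := by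
      rw [pow_succ', Module.End.mul_apply, map_sub, Pi.sub_apply]
      ring
    have hg := killedStep_univ_inv_one_add_znorm_le hp hb x
    have key : ∀ s : ℝ, |s| = 1 →
        s * Q ((Q ^ n) h - h) x ≤ c' * Q (fun z => (1 + znorm z)⁻¹) x := by
      intro s hs
      suffices H : Q (s • ((Q ^ n) h - h)) x ≤ Q (c' • fun z => (1 + znorm z)⁻¹) x by
        simpa only [map_smul, Pi.smul_apply, smul_eq_mul] using H
      refine killedStep_le hp fun y hy => ?_
      simp only [Set.indicator_univ, Pi.smul_apply, Pi.sub_apply, smul_eq_mul]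
      refine (le_abs_self _).trans ?_
      rw [abs_mul, hs, one_mul]
      exact ih _ (hG x hx y hy)
    have k1 := key 1 (by simp)
    have k2 := key (-1) (by simp)
    have k3 := mul_le_mul_of_nonneg_left hg hc'
    rw [← hQ] at k3
    have k4 : |Q ((Q ^ n) h - h) x| ≤ c' * (1 + b) * (1 + znorm x)⁻¹ :=
      abs_le.2 ⟨by linarith, by linarith⟩
    rw [e]
    refine (abs_add_le _ _).trans ?_
    linarith [hh x hx]

/-- Point masses charged by the `n`-step law bound expectations from below. -/
lemma mul_add_le_killedStep_univ_pow (hp : IsBoundedJumpLaw p D b) {f : ℤ × ℤ → ℝ} (hf : 0 ≤ f)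
    {κ : ℝ} {n : ℕ} {x u v : ℤ × ℤ} (huv : u ≠ v)
    (hu : κ ≤ (killedStep p D Set.univ ^ n) (Set.indicator {u} 1) x)
    (hv : κ ≤ (killedStep p D Set.univ ^ n) (Set.indicator {v} 1) x) :
    κ * (f u + f v) ≤ (killedStep p D Set.univ ^ n) f x := by
  have h : f u • Set.indicator {u} 1 + f v • Set.indicator {v} 1 ≤ f := by
    intro z
    simp only [Pi.add_apply, Pi.smul_apply, smul_eq_mul, Set.indicator_apply,
      Set.mem_singleton_iff, Pi.one_apply]
    have := hf z
    simp only [Pi.zero_apply] at this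
    by_cases h1 : z = u
    · subst h1
      simp [huv]
    · by_cases h2 : z = v
      · subst h2
        simp [h1]
      · simpa [h1, h2] using this
  have h2 := killedStep_pow_mono_of_le (V := Set.univ) hp h n x
  simp only [map_add, map_smul, Pi.add_apply, Pi.smul_apply, smul_eq_mul] at h2
  have hu' := mul_le_mul_of_nonneg_left hu (hf u)
  have hv' := mul_le_mul_of_nonneg_left hv (hf v)
  linarith

lemma killedStep_univ_fst_sub (hp : IsBoundedJumpLaw p D b) (x : ℤ × ℤ) :
    killedStep p D Set.univ (fun z => (z.1 : ℝ)) x - x.1 = ∑ y ∈ D, p x y * y.1 := by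
  have := congrArg (· * (x.1 : ℝ)) (hp.sum_eq_one x)
  simp only [Finset.sum_mul, one_mul] at this
  rw [killedStep_univ_apply, sub_eq_iff_eq_add']
  nth_rw 1 [← this]
  rw [← Finset.sum_add_distrib]
  refine Finset.sum_congr rfl fun y _ => ?_
  simp
  ring

lemma killedStep_univ_snd_sub (hp : IsBoundedJumpLaw p D b) (x : ℤ × ℤ) :
    killedStep p D Set.univ (fun z => (z.2 : ℝ)) x - x.2 = ∑ y ∈ D, p x y * y.2 := by
  have := congrArg (· * (x.2 : ℝ)) (hp.sum_eq_one x)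
  simp only [Finset.sum_mul, one_mul] at this
  rw [killedStep_univ_apply, sub_eq_iff_eq_add']
  nth_rw 1 [← this]
  rw [← Finset.sum_add_distrib]
  refine Finset.sum_congr rfl fun y _ => ?_
  simp
  ring

/-- The walk is at most diffusive. -/
lemma killedStep_pow_one_add_sq_le (hp : IsBoundedJumpLaw p D b)
    (hG : ∀ x ∈ G, ∀ y, p x y ≠ 0 → x + y ∈ G) {c : ℝ} (hc : 0 ≤ c)
    (h1 : ∀ x ∈ G, |∑ y ∈ D, p x y * (y.1 : ℝ)| ≤ c * (1 + znorm x)⁻¹)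
    (h2 : ∀ x ∈ G, |∑ y ∈ D, p x y * (y.2 : ℝ)| ≤ c * (1 + znorm x)⁻¹) (n : ℕ) :
    ∀ x ∈ G, (killedStep p D V ^ n) (fun z => 1 + znorm z ^ 2) x ≤
      1 + znorm x ^ 2 + (4 * c + b ^ 2) * n := by
  have step : ∀ x ∈ G, killedStep p D V (fun z => 1 + znorm z ^ 2) x ≤
      1 + znorm x ^ 2 + (4 * c + b ^ 2) := by
    intro x hx
    have hr := znorm_nonneg x
    have e1 : killedStep p D V (fun z => 1 + znorm z ^ 2) x ≤
        ∑ y ∈ D, p x y * (1 + znorm x ^ 2 + 2 * x.1 * y.1 + 2 * x.2 * y.2 + b ^ 2) := by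
      refine Finset.sum_le_sum fun y _ => ?_
      by_cases hy : p x y = 0
      · simp [hy]
      refine mul_le_mul_of_nonneg_left ?_ (hp.nonneg x y)
      refine (Set.indicator_le_self' (fun _ _ => by positivity) (x + y)).trans ?_
      have hyb : znorm y ^ 2 ≤ b ^ 2 := by
        have := znorm_nonneg y
        have := hp.znorm_le x y hy
        gcongr
      rw [znorm_sq] at hyb ⊢
      rw [znorm_sq]
      simp
      nlinarith
    have e2 : ∑ y ∈ D, p x y * (1 + znorm x ^ 2 + 2 * x.1 * y.1 + 2 * x.2 * y.2 + b ^ 2) =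
        1 + znorm x ^ 2 + b ^ 2 + 2 * x.1 * ∑ y ∈ D, p x y * (y.1 : ℝ) +
          2 * x.2 * ∑ y ∈ D, p x y * (y.2 : ℝ) := by
      have := congrArg (· * (1 + znorm x ^ 2 + b ^ 2)) (hp.sum_eq_one x)
      simp only [Finset.sum_mul, one_mul] at this
      rw [← this, Finset.mul_sum, Finset.mul_sum, ← Finset.sum_add_distrib,
        ← Finset.sum_add_distrib]
      refine Finset.sum_congr rfl fun y _ => ?_
      ring
    have bound : ∀ s t : ℝ, |s| ≤ znorm x → |t| ≤ c * (1 + znorm x)⁻¹ → s * t ≤ c := by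
      intro s t hs ht
      calc s * t ≤ |s| * |t| := by rw [← abs_mul]; exact le_abs_self _
        _ ≤ znorm x * (c * (1 + znorm x)⁻¹) := by gcongr
        _ = c * (znorm x / (1 + znorm x)) := by ring
        _ ≤ c * 1 := by
          gcongr
          exact (div_le_one (by linarith)).2 (by linarith)
        _ = c := mul_one c
    have b1 := bound _ _ (abs_fst_le_znorm x) (h1 x hx)
    have b2 := bound _ _ (abs_snd_le_znorm x) (h2 x hx)
    linarith
  have hL : 0 ≤ 4 * c + b ^ 2 := by positivity
  induction n with
  | zero => intro x _; simp
  | succ n ih =>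
    intro x hx
    rw [pow_succ', Module.End.mul_apply]
    have e : killedStep p D V ((killedStep p D V ^ n) (fun z => 1 + znorm z ^ 2)) x ≤
        killedStep p D V ((fun z => 1 + znorm z ^ 2) + ((4 * c + b ^ 2) * n) • 1) x := by
      refine killedStep_le hp fun y hy => ?_
      by_cases hV : x + y ∈ V
      · simp only [Set.indicator_of_mem hV]
        simpa using ih _ (hG x hx y hy)
      · simp [hV]
    rw [map_add, map_smul, Pi.add_apply, Pi.smul_apply, smul_eq_mul] at e
    have e2 := mul_le_mul_of_nonneg_left (killedStep_one_le (V := V) hp x)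
      (show 0 ≤ (4 * c + b ^ 2) * (n : ℝ) by positivity)
    simp only [Pi.one_apply] at e2
    push_cast
    linarith [step x hx]

end Moments

section Angular

variable {p : ℤ × ℤ → ℤ × ℤ → ℝ} {D : Finset (ℤ × ℤ)} {b : ℝ} {W G : Set (ℤ × ℤ)}

lemma norm_latticePoint_sub_le_of_step (hp : IsBoundedJumpLaw p D b) {x z y : ℤ × ℤ} {j : ℕ}
    (hz : ‖latticePoint z - latticePoint x‖ ≤ j * b) (hy : p z y ≠ 0) :
    ‖latticePoint (z + y) - latticePoint x‖ ≤ (j + 1 : ℕ) * b := by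
  have h1 := hp.znorm_le z y hy
  rw [← norm_latticePoint] at h1
  have h2 := norm_add_le (latticePoint z - latticePoint x) (latticePoint y)
  rw [latticePoint_add, add_sub_right_comm]
  push_cast
  linarith

/-- Far from the origin, a suitable exponential of the angular increment strictly grows in mean,
at a rate comparable to `‖x‖⁻²`. -/
lemma exists_angular_growth (hp : IsBoundedJumpLaw p D b) (hb : 0 ≤ b)
    (hG : ∀ x ∈ G, ∀ y, p x y ≠ 0 → x + y ∈ G) {c : ℝ} (hc : 0 ≤ c)
    (h1 : ∀ x ∈ G, |∑ y ∈ D, p x y * (y.1 : ℝ)| ≤ c * (1 + znorm x)⁻¹)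
    (h2 : ∀ x ∈ G, |∑ y ∈ D, p x y * (y.2 : ℝ)| ≤ c * (1 + znorm x)⁻¹)
    {κ : ℝ} {k : ℕ} (hκ : 0 < κ) (hk : 0 < k) (n : ℕ)
    (hu : ∀ x ∈ G, κ ≤ (killedStep p D Set.univ ^ n) (Set.indicator {x + ((k : ℤ), 0)} 1) x)
    (hv : ∀ x ∈ G, κ ≤ (killedStep p D Set.univ ^ n) (Set.indicator {x + (0, (k : ℤ))} 1) x) :
    ∃ l R : ℝ, 0 ≤ l ∧ 0 < R ∧ ∀ x ∈ G, R ≤ znorm x →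
      1 + (1 + znorm x ^ 2)⁻¹ ≤ (killedStep p D Set.univ ^ n)
        (fun z => Real.exp (l * Complex.arg (latticePoint z / latticePoint x))) x := by
  obtain ⟨c₁, hc₁, hd₁⟩ := exists_abs_killedStep_univ_pow_sub_le hp hb hG
    (h := fun z => (z.1 : ℝ)) hc (fun x hx => by rw [killedStep_univ_fst_sub hp]; exact h1 x hx) n
  obtain ⟨c₂, hc₂, hd₂⟩ := exists_abs_killedStep_univ_pow_sub_le hp hb hG
    (h := fun z => (z.2 : ℝ)) hc (fun x hx => by rw [killedStep_univ_snd_sub hp]; exact h2 x hx) n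
  have hk' : (0 : ℝ) < k := by exact_mod_cast hk
  set B : ℝ := n * b with hB
  have hB0 : 0 ≤ B := by positivity
  set l : ℝ := 8 * (c₁ + c₂ + B ^ 2 + 2) / (κ * k ^ 2) + 1 with hl
  have hl1 : 1 ≤ l := by
    have : 0 ≤ 8 * (c₁ + c₂ + B ^ 2 + 2) / (κ * k ^ 2) := by positivity
    linarith
  have hlκ : c₁ + c₂ + B ^ 2 + 2 ≤ l * (κ * k ^ 2) / 8 := by
    have : 8 * (c₁ + c₂ + B ^ 2 + 2) / (κ * k ^ 2) * (κ * k ^ 2) =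
        8 * (c₁ + c₂ + B ^ 2 + 2) := by field_simp
    have h0 : 0 < κ * (k : ℝ) ^ 2 := by positivity
    rw [hl, add_mul, this]
    linarith
  refine ⟨l, 2 * B + 2 * l * B + l * B ^ 2 + 1, by linarith, by positivity, fun x hx hR => ?_⟩
  set r := znorm x with hr
  have hlB : 0 ≤ l * B := by positivity
  have hlB2 : 0 ≤ l * B ^ 2 := by positivity
  have hr0 : 0 < r := by linarith
  have hx0 : latticePoint x ≠ 0 := by
    rw [← norm_pos_iff, norm_latticePoint]
    exact hr0
  set q := (r ^ 2)⁻¹ with hq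
  have hq0 : 0 < q := by positivity
  set Q := killedStep p D Set.univ with hQ
  let T : ℤ × ℤ → ℝ := (x.1 * q) • (fun z : ℤ × ℤ => (z.2 : ℝ)) -
    (x.2 * q) • (fun z : ℤ × ℤ => (z.1 : ℝ))
  have hT : ∀ z, T z = (latticePoint z / latticePoint x).im := by
    intro z
    rw [latticePoint_div_im, div_eq_mul_inv, ← hr, ← hq]
    simp only [T, Pi.sub_apply, Pi.smul_apply, smul_eq_mul]
    ring
  set c₀ : ℝ := 1 - l * (B ^ 2 * q) - l ^ 2 / 4 * (B ^ 2 * q) ^ 2 with hc₀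
  have hlow : (Q ^ n) ((fun _ => c₀) + l • T + (l ^ 2 / 8) • fun z => T z ^ 2) x ≤
      (Q ^ n) (fun z => Real.exp (l * Complex.arg (latticePoint z / latticePoint x))) x := by
    refine killedStep_pow_le hp (fun j z => ‖latticePoint z - latticePoint x‖ ≤ j * b)
      (fun j z y hz hy _ => norm_latticePoint_sub_le_of_step hp hz hy) n 0 x (by simp)
      fun z hz => ?_
    rw [zero_add, ← hB] at hz
    set w := latticePoint z / latticePoint x - 1 with hw
    have hwn : ‖w‖ ≤ B / r := by
      rw [hw, div_sub_one hx0, norm_div, norm_latticePoint x]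
      gcongr
    have hw1 : ‖w‖ * r ≤ B := (le_div_iff₀ hr0).1 hwn
    have hwi : w.im = T z := by rw [hT, hw]; simp
    have hwq : ‖w‖ ^ 2 ≤ B ^ 2 * q := by
      calc ‖w‖ ^ 2 ≤ (B / r) ^ 2 := by gcongr
        _ = B ^ 2 * q := by rw [hq]; field_simp
    have hn := norm_nonneg w
    have hBr : B / r ≤ 1 / 2 := by
      rw [div_le_div_iff₀ hr0 two_pos]
      linarith
    have hlBr : 2 * l * (B / r) ≤ 1 := by
      rw [← mul_div_assoc, div_le_one hr0]
      linarith
    have e := le_exp_mul_arg_one_add (l := l) (w := w) (by linarith) (hwn.trans hBr)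
      ((mul_le_mul_of_nonneg_left hwn (by positivity)).trans hlBr)
    have hw1z : 1 + w = latticePoint z / latticePoint x := by rw [hw]; ring
    rw [hw1z, hwi] at e
    refine le_trans ?_ e
    have hw4 : ‖w‖ ^ 4 ≤ (B ^ 2 * q) ^ 2 := by
      calc ‖w‖ ^ 4 = (‖w‖ ^ 2) ^ 2 := by ring
        _ ≤ _ := by gcongr
    have e1 := mul_le_mul_of_nonneg_left hwq (show 0 ≤ l by linarith)
    have e2 := mul_le_mul_of_nonneg_left hw4 (show 0 ≤ l ^ 2 / 4 by positivity)
    simp only [Pi.add_apply, Pi.smul_apply, smul_eq_mul, hc₀]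
    linarith
  refine le_trans ?_ hlow
  simp only [map_add, map_smul, Pi.add_apply, Pi.smul_apply, smul_eq_mul]
  rw [killedStep_univ_pow_const hp]
  have hdT : -((c₁ + c₂) * q) ≤ (Q ^ n) T x := by
    have hb1 := hd₁ x hx
    have hb2 := hd₂ x hx
    have bound : ∀ s t c' : ℝ, 0 ≤ c' → |s| ≤ r → |t| ≤ c' * (1 + r)⁻¹ → |s * t| ≤ c' := by
      intro s t c' hc' hs ht
      rw [abs_mul]
      calc |s| * |t| ≤ r * (c' * (1 + r)⁻¹) := by gcongr
        _ = c' * (r / (1 + r)) := by ring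
        _ ≤ c' * 1 := by
          gcongr
          exact (div_le_one (by linarith)).2 (by linarith)
        _ = c' := mul_one c'
    have b1 := abs_le.1 (bound _ _ _ hc₁ (abs_snd_le_znorm x) hb1)
    have b2 := abs_le.1 (bound _ _ _ hc₂ (abs_fst_le_znorm x) hb2)
    simp only [T, map_sub, map_smul, Pi.sub_apply, Pi.smul_apply, smul_eq_mul]
    nlinarith
  have hdT2 : κ * k ^ 2 * q ≤ (Q ^ n) (fun z => T z ^ 2) x := by
    refine le_trans (le_of_eq ?_) (mul_add_le_killedStep_univ_pow hp
      (fun z => sq_nonneg (T z)) ?_ (hu x hx) (hv x hx))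
    · have hrr : ((x.1 : ℝ) ^ 2 + (x.2 : ℝ) ^ 2) * q = 1 := by
        rw [← znorm_sq, ← hr, hq]
        field_simp
      simp only [T, Pi.sub_apply, Pi.smul_apply, smul_eq_mul, Prod.fst_add, Prod.snd_add]
      push_cast
      linear_combination (-κ * k ^ 2 * q) * hrr
    · intro h
      have := congrArg Prod.fst h
      simp at this
      omega
  have hBq : (l * B ^ 2) ^ 2 * q ≤ 1 := by
    rw [hq, ← div_eq_mul_inv, div_le_one (by positivity)]
    gcongr
    linarith
  have f1 := mul_le_mul_of_nonneg_left hdT (show 0 ≤ l by linarith)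
  have f2 := mul_le_mul_of_nonneg_left hdT2 (show 0 ≤ l ^ 2 / 8 by positivity)
  have f3 := mul_le_mul_of_nonneg_right hBq hq0.le
  have f4 := mul_le_mul_of_nonneg_left hlκ (show 0 ≤ l * q by positivity)
  have f5 : q ≤ l * q := le_mul_of_one_le_left hq0.le hl1
  have f6 : (1 + r ^ 2)⁻¹ ≤ q := by
    rw [hq]
    gcongr
    linarith
  simp only [hc₀]
  nlinarith

/-- On paths that stay away from the strip around the cut, the exponential of the angle agrees
with its continuous lift; the discrepancy is controlled by the killing probability. -/
lemma lifted_sub_le_killedStep_pow (hp : IsBoundedJumpLaw p D b) (hb : 0 ≤ b) {l R₀ : ℝ}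
    (hl : 0 ≤ l)
    (hW : ∀ z ∈ W, R₀ ≤ znorm z → ¬ ((z.1 : ℝ) ≤ 0 ∧ |(z.2 : ℝ)| ≤ b)) {x : ℤ × ℤ} {n : ℕ}
    (hx : R₀ + b + n * b < znorm x) (hR₀ : 0 ≤ R₀) (m : ℕ) :
    ∀ (j : ℕ) (z : ℤ × ℤ), j + m ≤ n → z ∈ W →
      ‖latticePoint z - latticePoint x‖ ≤ j * b →
      ang z = ang x + Complex.arg (latticePoint z / latticePoint x) →
      (killedStep p D Set.univ ^ m) (fun z => Real.exp (l * ang x) *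
          Real.exp (l * Complex.arg (latticePoint z / latticePoint x))) z -
        Real.exp (2 * Real.pi * l) * (1 - (killedStep p D W ^ m) 1 z) ≤
        (killedStep p D W ^ m) (fun z => Real.exp (l * ang z)) z := by
  set F : ℤ × ℤ → ℝ := fun z => Real.exp (l * ang x) *
    Real.exp (l * Complex.arg (latticePoint z / latticePoint x)) with hF
  set M := Real.exp (2 * Real.pi * l) with hM
  have hFM : F ≤ fun _ => M := by
    intro z
    simp only [hF, hM, ← Real.exp_add]
    have a1 := Complex.arg_le_pi (latticePoint z / latticePoint x)
    have a2 : ang x ≤ Real.pi := Complex.arg_le_pi _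
    gcongr
    nlinarith
  have hnb : 0 ≤ n * b := by positivity
  induction m with
  | zero =>
    intro j z _ _ _ hz
    simp only [pow_zero, Module.End.one_apply, Pi.one_apply, sub_self, mul_zero, sub_zero, hF]
    rw [hz, mul_add, Real.exp_add]
  | succ m ih =>
    intro j z hj hzW hzx hz
    have hj' : (j : ℝ) * b ≤ n * b := by
      have : j ≤ n := by omega
      gcongr
    have hzx' : ‖latticePoint z - latticePoint x‖ ≤ n * b := hzx.trans hj'
    have hzn : R₀ + b < znorm z := by
      have := norm_sub_norm_le (latticePoint x) (latticePoint z)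
      rw [norm_sub_rev, norm_latticePoint, norm_latticePoint] at this
      linarith
    have e1 : ∑ y ∈ D, p z y * ((killedStep p D Set.univ ^ m) F (z + y) -
        M * (1 - W.indicator ((killedStep p D W ^ m) 1) (z + y))) ≤
        (killedStep p D W ^ (m + 1)) (fun z => Real.exp (l * ang z)) z := by
      rw [pow_succ', Module.End.mul_apply, killedStep_apply]
      refine Finset.sum_le_sum fun y _ => ?_
      by_cases hy : p z y = 0
      · simp [hy]
      refine mul_le_mul_of_nonneg_left ?_ (hp.nonneg z y)
      by_cases hyW : z + y ∈ W
      · rw [Set.indicator_of_mem hyW, Set.indicator_of_mem hyW]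
        refine ih (j + 1) _ (by omega) hyW (norm_latticePoint_sub_le_of_step hp hzx hy) ?_
        have hyb : ‖latticePoint (z + y) - latticePoint z‖ ≤ b := by
          rw [latticePoint_add, add_sub_cancel_left, norm_latticePoint]
          exact hp.znorm_le z y hy
        refine arg_eq_arg_add_arg_div_trans (x := latticePoint x) (z := latticePoint z)
          (z' := latticePoint (z + y)) ?_ ?_ hz
          (arg_eq_arg_add_arg_div (hW z hzW (by linarith)) hyb ?_)
        · rw [norm_latticePoint x]
          linarith
        · rw [norm_latticePoint z]
          linarith
        · rw [norm_latticePoint z]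
          linarith
      · rw [Set.indicator_of_notMem hyW, Set.indicator_of_notMem hyW]
        have := killedStep_pow_mono_of_le (V := Set.univ) hp hFM m (z + y)
        rw [killedStep_univ_pow_const hp] at this
        linarith
    refine le_trans (le_of_eq ?_) e1
    simp only [pow_succ' _ m, Module.End.mul_apply]
    rw [killedStep_univ_apply, killedStep_apply]
    nth_rw 1 [← hp.sum_eq_one z]
    rw [← Finset.sum_sub_distrib, Finset.mul_sum, ← Finset.sum_sub_distrib]
    refine Finset.sum_congr rfl fun y _ => ?_
    ring

end Angular

section Survival

variable {p : ℤ × ℤ → ℤ × ℤ → ℝ} {D : Finset (ℤ × ℤ)} {b : ℝ} {W G : Set (ℤ × ℤ)}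

lemma finite_setOf_znorm_lt (R : ℝ) : {x : ℤ × ℤ | znorm x < R}.Finite := by
  refine (Set.finite_Icc ((-⌈R⌉, -⌈R⌉) : ℤ × ℤ) (⌈R⌉, ⌈R⌉)).subset fun x hx => ?_
  have h1 := abs_le.1 ((abs_fst_le_znorm x).trans ((le_of_lt hx).trans (Int.le_ceil R)))
  have h2 := abs_le.1 ((abs_snd_le_znorm x).trans ((le_of_lt hx).trans (Int.le_ceil R)))
  simp only [Set.mem_Icc, Prod.le_def]
  norm_cast at h1 h2
  exact ⟨⟨h1.1, h2.1⟩, h1.2, h2.2⟩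

lemma exists_uniform_killing (hp : IsBoundedJumpLaw p D b) {s : Set (ℤ × ℤ)} (hs : s.Finite)
    (h : ∀ x ∈ s, ∃ m, (killedStep p D W ^ m) 1 x < 1) :
    ∃ m : ℕ, ∃ δ : ℝ, 0 < δ ∧ ∀ x ∈ s, (killedStep p D W ^ m) 1 x ≤ 1 - δ := by
  induction s, hs using Set.Finite.induction_on with
  | empty => exact ⟨0, 1, one_pos, by simp⟩
  | @insert a s _ _ ih =>
    obtain ⟨m, δ, hδ, hm⟩ := ih fun x hx => h x (Set.mem_insert_of_mem _ hx)
    obtain ⟨m', hm'⟩ := h a (Set.mem_insert _ _)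
    refine ⟨max m m', min δ (1 - (killedStep p D W ^ m') 1 a),
      lt_min hδ (by linarith), fun x hx => ?_⟩
    rcases Set.mem_insert_iff.1 hx with rfl | hx
    · have := killedStep_pow_one_antitone (V := W) hp x (le_max_right m m')
      simp only at this
      linarith [min_le_right δ (1 - (killedStep p D W ^ m') 1 x)]
    · have := killedStep_pow_one_antitone (V := W) hp x (le_max_left m m')
      simp only at this
      linarith [hm x hx, min_le_left δ (1 - (killedStep p D W ^ m') 1 a)]

/-- Lyapunov inequality: a bounded function of the angle grows in mean at rate `‖x‖⁻²`, up to
the probability of being killed. -/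
lemma exists_lyapunov (hp : IsBoundedJumpLaw p D b) (hb : 0 ≤ b)
    (hG : ∀ x ∈ G, ∀ y, p x y ≠ 0 → x + y ∈ G) {c : ℝ} (hc : 0 ≤ c)
    (h1 : ∀ x ∈ G, |∑ y ∈ D, p x y * (y.1 : ℝ)| ≤ c * (1 + znorm x)⁻¹)
    (h2 : ∀ x ∈ G, |∑ y ∈ D, p x y * (y.2 : ℝ)| ≤ c * (1 + znorm x)⁻¹)
    {κ : ℝ} {k n : ℕ} (hκ : 0 < κ) (hk : 0 < k) (hn : 0 < n)
    (hu : ∀ x ∈ G, κ ≤ (killedStep p D Set.univ ^ n) (Set.indicator {x + ((k : ℤ), 0)} 1) x)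
    (hv : ∀ x ∈ G, κ ≤ (killedStep p D Set.univ ^ n) (Set.indicator {x + (0, (k : ℤ))} 1) x)
    {R₀ : ℝ} (hR₀ : 0 ≤ R₀)
    (hW : ∀ z ∈ W, R₀ ≤ znorm z → ¬ ((z.1 : ℝ) ≤ 0 ∧ |(z.2 : ℝ)| ≤ b))
    (hexit : ∀ x ∈ G ∩ W, ∃ m, (killedStep p D W ^ m) 1 x < 1) :
    ∃ (F : ℤ × ℤ → ℝ) (M a A : ℝ) (m : ℕ), 0 ≤ F ∧ (F ≤ fun _ => M) ∧ 0 < a ∧ 0 ≤ A ∧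
      ∀ x ∈ G ∩ W, a * (1 + znorm x ^ 2)⁻¹ ≤
        (killedStep p D W ^ n) F x - F x + A * (1 - (killedStep p D W ^ (n * m)) 1 x) := by
  obtain ⟨l, R, hl, hR, hlR⟩ := exists_angular_growth hp hb hG hc h1 h2 hκ hk n hu hv
  set R₁ := R + R₀ + b + n * b + 1 with hR₁
  obtain ⟨m, δ, hδ, hm⟩ := exists_uniform_killing (W := W) hp
    ((finite_setOf_znorm_lt R₁).inter_of_left (G ∩ W)) fun x hx => hexit x hx.2
  have hπ := Real.pi_pos
  have hnb : 0 ≤ n * b := by positivity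
  set F : ℤ × ℤ → ℝ := fun z => Real.exp (l * ang z) with hF
  set M := Real.exp (2 * Real.pi * l) with hM
  have hF0 : 0 ≤ F := fun z => (Real.exp_pos _).le
  have hFM : F ≤ fun _ => M := by
    intro z
    have : ang z ≤ Real.pi := Complex.arg_le_pi _
    simp only [hF, hM]
    rw [Real.exp_le_exp]
    nlinarith
  have hM0 : 0 < M := Real.exp_pos _
  refine ⟨F, M, Real.exp (-(l * Real.pi)), M + (1 + M) / δ, m + 1, hF0, hFM, Real.exp_pos _,
    by positivity, fun x hx => ?_⟩
  have hKF := killedStep_pow_nonneg (V := W) hp hF0 n x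
  have hle := killedStep_pow_one_le (V := W) hp (n * (m + 1)) x
  have hg0 : 0 ≤ (1 + znorm x ^ 2)⁻¹ := by positivity
  have hanti := killedStep_pow_one_antitone (V := W) hp x
  by_cases hxR : znorm x < R₁
  · have e1 := hm x ⟨hxR, hx⟩
    have e2 := hanti (show m ≤ n * (m + 1) by nlinarith)
    simp only at e2
    have e3 : (1 + znorm x ^ 2)⁻¹ ≤ 1 := inv_le_one_of_one_le₀ (by linarith [sq_nonneg (znorm x)])
    have e4 : Real.exp (-(l * Real.pi)) ≤ 1 := Real.exp_le_one_iff.2 (by nlinarith)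
    have e5 : 1 + M ≤ (1 + M) / δ * (1 - (killedStep p D W ^ (n * (m + 1))) 1 x) := by
      calc 1 + M = (1 + M) / δ * δ := by field_simp
        _ ≤ _ := by
          gcongr
          linarith
    have e6 : 0 ≤ M * (1 - (killedStep p D W ^ (n * (m + 1))) 1 x) :=
      mul_nonneg hM0.le (by linarith)
    have e7 := mul_le_one₀ e4 hg0 e3
    have e8 := hFM x
    simp only at e8
    linarith
  · have hxR' : R₁ ≤ znorm x := not_lt.1 hxR
    have hx0 : latticePoint x ≠ 0 := by
      rw [← norm_pos_iff, norm_latticePoint]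
      linarith
    have e1 := lifted_sub_le_killedStep_pow (n := n) (x := x) hp hb hl hW (by linarith) hR₀ n 0 x
      (by simp) hx.2 (by simp) (by simp [div_self hx0])
    have e2 := hlR x hx.1 (by linarith)
    have e3 : (killedStep p D Set.univ ^ n) (fun z => Real.exp (l * ang x) *
          Real.exp (l * Complex.arg (latticePoint z / latticePoint x))) x =
        F x * (killedStep p D Set.univ ^ n) (fun z =>
          Real.exp (l * Complex.arg (latticePoint z / latticePoint x))) x :=
      congrFun (map_smul (killedStep p D Set.univ ^ n) (F x) (fun z =>
          Real.exp (l * Complex.arg (latticePoint z / latticePoint x)))) x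
    rw [e3] at e1
    have e4 := mul_le_mul_of_nonneg_left e2 (hF0 x)
    have e5 : Real.exp (-(l * Real.pi)) ≤ F x := by
      have : -Real.pi < ang x := Complex.neg_pi_lt_arg _
      simp only [hF]
      gcongr
      nlinarith
    have e6 := mul_le_mul_of_nonneg_right e5 hg0
    have e7 := hanti (show n ≤ n * (m + 1) by nlinarith)
    simp only at e7
    have e8 := mul_le_mul_of_nonneg_left e7 hM0.le
    have e9 : 0 ≤ (1 + M) / δ * (1 - (killedStep p D W ^ (n * (m + 1))) 1 x) :=
      mul_nonneg (by positivity) (by linarith)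
    linarith

lemma sum_range_sub_add_le {u : ℕ → ℝ} (h0 : ∀ t, 0 ≤ u t) (h1 : ∀ t, u t ≤ 1) (m T : ℕ) :
    ∑ t ∈ Finset.range T, (u t - u (t + m)) ≤ m := by
  have e1 := Finset.sum_range_add u m T
  have e2 : ∑ t ∈ Finset.range T, u t ≤ ∑ t ∈ Finset.range (m + T), u t :=
    Finset.sum_le_sum_of_subset_of_nonneg (Finset.range_mono (by omega)) fun t _ _ => h0 t
  have e3 : ∑ t ∈ Finset.range m, u t ≤ m := by
    simpa using Finset.sum_le_sum fun t (_ : t ∈ Finset.range m) => h1 t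
  rw [Finset.sum_sub_distrib]
  simp only [add_comm _ m]
  linarith

lemma tendsto_killedStep_pow_one (hp : IsBoundedJumpLaw p D b) (hb : 0 ≤ b)
    (hG : ∀ x ∈ G, ∀ y, p x y ≠ 0 → x + y ∈ G) {c : ℝ} (hc : 0 ≤ c)
    (h1 : ∀ x ∈ G, |∑ y ∈ D, p x y * (y.1 : ℝ)| ≤ c * (1 + znorm x)⁻¹)
    (h2 : ∀ x ∈ G, |∑ y ∈ D, p x y * (y.2 : ℝ)| ≤ c * (1 + znorm x)⁻¹)
    {κ : ℝ} {k n : ℕ} (hκ : 0 < κ) (hk : 0 < k) (hn : 0 < n)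
    (hu : ∀ x ∈ G, κ ≤ (killedStep p D Set.univ ^ n) (Set.indicator {x + ((k : ℤ), 0)} 1) x)
    (hv : ∀ x ∈ G, κ ≤ (killedStep p D Set.univ ^ n) (Set.indicator {x + (0, (k : ℤ))} 1) x)
    {R₀ : ℝ} (hR₀ : 0 ≤ R₀)
    (hW : ∀ z ∈ W, R₀ ≤ znorm z → ¬ ((z.1 : ℝ) ≤ 0 ∧ |(z.2 : ℝ)| ≤ b))
    (hexit : ∀ x ∈ G ∩ W, ∃ m, (killedStep p D W ^ m) 1 x < 1) {x : ℤ × ℤ} (hx : x ∈ G ∩ W) :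
    Tendsto (fun m => (killedStep p D W ^ m) 1 x) atTop (𝓝 0) := by
  obtain ⟨F, M, a, A, m, hF0, hFM, ha, hA, hFA⟩ :=
    exists_lyapunov hp hb hG hc h1 h2 hκ hk hn hu hv hR₀ hW hexit
  set K := killedStep p D W with hK
  have hu0 : ∀ t, 0 ≤ (K ^ t) 1 x := fun t => killedStep_pow_nonneg hp zero_le_one t x
  have hbdd : BddBelow (Set.range fun m => (K ^ m) 1 x) := ⟨0, by rintro _ ⟨t, rfl⟩; exact hu0 t⟩
  have hlim := tendsto_atTop_ciInf (killedStep_pow_one_antitone (V := W) hp x) hbdd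
  set U := ⨅ m, (K ^ m) 1 x with hU
  have hU0 : 0 ≤ U := le_ciInf hu0
  have hUle : ∀ t, U ≤ (K ^ t) 1 x := fun t => ciInf_le hbdd t
  set L := 4 * c + b ^ 2 with hL
  have hL0 : 0 ≤ L := by positivity
  set H := 1 + znorm x ^ 2 + L * n with hH
  have hH0 : 0 < H := by positivity
  have hKG : ∀ z ∈ G ∩ W, ∀ y, p z y ≠ 0 → z + y ∈ W → z + y ∈ G ∩ W :=
    fun z hz y hy hzy => ⟨hG z hz.1 y hy, hzy⟩
  have hlower : ∀ t : ℕ, U ^ 2 / (H * (t + 1)) ≤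
      (K ^ (n * t)) (fun z => (1 + znorm z ^ 2)⁻¹) x := by
    intro t
    set s := U / (H * (t + 1)) with hs
    have hs0 : 0 ≤ s := by positivity
    have e1 : (K ^ (n * t)) ((2 * s) • 1 - (s ^ 2) • fun z => 1 + znorm z ^ 2) x ≤
        (K ^ (n * t)) (fun z => (1 + znorm z ^ 2)⁻¹) x := by
      refine killedStep_pow_mono_of_le hp (fun z => ?_) _ x
      have : 0 < 1 + znorm z ^ 2 := by positivity
      simp only [Pi.sub_apply, Pi.smul_apply, Pi.one_apply, smul_eq_mul, mul_one]
      rw [inv_eq_one_div, le_div_iff₀ this]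
      nlinarith [sq_nonneg (s * (1 + znorm z ^ 2) - 1)]
    refine le_trans ?_ e1
    simp only [map_sub, map_smul, Pi.sub_apply, Pi.smul_apply, smul_eq_mul]
    have e2 := killedStep_pow_one_add_sq_le (V := W) hp hG hc h1 h2 (n * t) x hx.1
    have e3 : 1 + znorm x ^ 2 + L * (n * t : ℕ) ≤ H * (t + 1) := by
      have : 0 ≤ (1 + znorm x ^ 2) * (t : ℝ) := by positivity
      have : 0 ≤ L * n := by positivity
      push_cast
      rw [hH]
      nlinarith
    have e4 := mul_le_mul_of_nonneg_left (e2.trans e3) (sq_nonneg s)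
    have e5 := mul_le_mul_of_nonneg_left (hUle (n * t)) hs0
    have hpos : 0 < H * ((t : ℝ) + 1) := by positivity
    have e6 : s ^ 2 * (H * (t + 1)) = U ^ 2 / (H * (t + 1)) := by
      rw [hs]
      field_simp
    have e7 : s * U = U ^ 2 / (H * (t + 1)) := by
      rw [hs]
      ring
    rw [← hK] at e4
    linarith
  have hstep : ∀ t : ℕ, a * (U ^ 2 / (H * (t + 1))) ≤
      ((K ^ (n * (t + 1))) F x - (K ^ (n * t)) F x) +
        A * ((K ^ (n * t)) 1 x - (K ^ (n * (t + m))) 1 x) := by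
    intro t
    have e1 := killedStep_pow_mono (V := W) hp hKG (f := a • fun z => (1 + znorm z ^ 2)⁻¹)
      (g := (K ^ n) F - F + A • (1 - (K ^ (n * m)) 1)) hFA (n * t) hx
    rw [← hK] at e1
    simp only [map_add, map_sub, map_smul, Pi.add_apply, Pi.sub_apply, Pi.smul_apply, smul_eq_mul,
      ← Module.End.mul_apply, ← pow_add, ← mul_add] at e1
    rw [mul_add_one n t]
    exact (mul_le_mul_of_nonneg_left (hlower t) ha.le).trans e1
  have hbound : ∀ T : ℕ, a * (U ^ 2 / H) * ∑ t ∈ Finset.range T, 1 / ((t : ℝ) + 1) ≤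
      M + A * m := by
    intro T
    have e1 := Finset.sum_le_sum fun t (_ : t ∈ Finset.range T) => hstep t
    rw [Finset.sum_add_distrib, Finset.sum_range_sub (fun t => (K ^ (n * t)) F x),
      ← Finset.mul_sum, ← Finset.mul_sum] at e1
    have e2 := sum_range_sub_add_le (u := fun t => (K ^ (n * t)) 1 x) (fun t => hu0 _)
      (fun t => killedStep_pow_one_le hp _ x) m T
    have e3 : (K ^ (n * T)) F x ≤ M := by
      have hM0 : 0 ≤ M := (hF0 x).trans (hFM x)
      have e := killedStep_pow_mono_of_le (V := W) hp (f := F) (g := M • 1)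
        (fun z => by simpa using hFM z) (n * T) x
      simp only [map_smul, Pi.smul_apply, smul_eq_mul] at e
      exact e.trans (mul_le_of_le_one_right hM0 (killedStep_pow_one_le hp _ x))
    have e4 := hF0 x
    have e5 := mul_le_mul_of_nonneg_left e2 hA
    simp only [mul_zero, pow_zero, Module.End.one_apply, Pi.zero_apply] at e1 e4 e5
    refine le_trans (le_of_eq ?_) (e1.trans (by linarith))
    rw [Finset.mul_sum, Finset.mul_sum]
    refine Finset.sum_congr rfl fun t _ => ?_
    field_simp
  have hUz : U = 0 := by
    by_contra hne
    have hUpos : 0 < U := lt_of_le_of_ne hU0 (Ne.symm hne)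
    have ht := Real.tendsto_sum_range_one_div_nat_succ_atTop.const_mul_atTop
      (show 0 < a * (U ^ 2 / H) by positivity)
    obtain ⟨T, hT⟩ := (ht.eventually_gt_atTop (M + A * m)).exists
    exact absurd (hbound T) (not_le.2 hT)
  rwa [hUz] at hlim

end Survival

section Exit

variable {p : ℤ × ℤ → ℤ × ℤ → ℝ} {D : Finset (ℤ × ℤ)} {b : ℝ} {W G : Set (ℤ × ℤ)}

/-- Far from the origin the wedge avoids the strip around the negative half-axis. -/
lemma exists_forall_mem_Wset_not_strip (b : ℝ) {α : ℝ} (hα0 : 0 < α) :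
    ∃ R₀ : ℝ, 0 ≤ R₀ ∧
      ∀ z ∈ Wset b α, R₀ ≤ znorm z → ¬ ((z.1 : ℝ) ≤ 0 ∧ |(z.2 : ℝ)| ≤ b) := by
  refine ⟨|b / Real.sin α|, abs_nonneg _, ?_⟩
  rintro z (⟨hα, hz⟩ | ⟨-, hz⟩) hr
  · rintro ⟨hz1, hz2⟩
    have hs := Real.sin_pos_of_pos_of_lt_pi hα0 hα
    have h1 := (le_abs_self _).trans hr
    rw [div_le_iff₀ hs] at h1
    have h2 : (z.1 : ℝ) ^ 2 < (znorm z * Real.cos α) ^ 2 := by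
      rw [sq_lt_sq, abs_of_nonpos hz1, abs_of_neg (hz.trans_le hz1)]
      linarith
    have h3 : (z.2 : ℝ) ^ 2 ≤ b ^ 2 := by
      rw [← sq_abs]
      gcongr
    have h4 : b ^ 2 ≤ (znorm z * Real.sin α) ^ 2 := by
      have := (abs_nonneg _).trans hz2
      gcongr
    have h5 := znorm_sq z
    have h6 : (znorm z * Real.cos α) ^ 2 + (znorm z * Real.sin α) ^ 2 = znorm z ^ 2 := by
      linear_combination znorm z ^ 2 * Real.sin_sq_add_cos_sq α
    linarith
  · exact hz

/-- The states from which the walk is certain to stay in `W`. -/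
def trappedStates (p : ℤ × ℤ → ℤ × ℤ → ℝ) (D : Finset (ℤ × ℤ)) (W : Set (ℤ × ℤ)) :
    Set (ℤ × ℤ) :=
  {x | x ∈ W ∧ ∀ m, 1 ≤ (killedStep p D W ^ m) 1 x}

lemma add_mem_trappedStates (hp : IsBoundedJumpLaw p D b) {x y : ℤ × ℤ}
    (hx : x ∈ trappedStates p D W) (hy : p x y ≠ 0) : x + y ∈ trappedStates p D W := by
  have key : ∀ m, 1 ≤ W.indicator ((killedStep p D W ^ m) 1) (x + y) := by
    intro m
    by_contra! hlt
    have hsum : ∑ y ∈ D, p x y * W.indicator ((killedStep p D W ^ m) 1) (x + y) <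
        ∑ y ∈ D, p x y := by
      refine Finset.sum_lt_sum (fun z _ => mul_le_of_le_one_right (hp.nonneg x z) ?_)
        ⟨y, hp.mem_of_ne_zero x y hy,
          mul_lt_of_lt_one_right (lt_of_le_of_ne (hp.nonneg x y) (Ne.symm hy)) hlt⟩
      exact Set.indicator_le' (fun _ _ => killedStep_pow_one_le hp m _)
        (fun _ _ => zero_le_one) _
    have h := hx.2 (m + 1)
    rw [pow_succ', Module.End.mul_apply, killedStep_apply] at h
    rw [hp.sum_eq_one] at hsum
    linarith
  have hW : x + y ∈ W := by
    by_contra hW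
    have := key 0
    rw [Set.indicator_of_notMem hW] at this
    linarith
  refine ⟨hW, fun m => ?_⟩
  simpa only [Set.indicator_of_mem hW] using key m

/-- A state charged by the `n`-step law is reached along an allowed path. -/
lemma mem_of_killedStep_univ_pow_pos (hp : IsBoundedJumpLaw p D b) {n : ℕ} {x u : ℤ × ℤ}
    (hu : 0 < (killedStep p D Set.univ ^ n) (Set.indicator {u} 1) x) (A : ℕ → ℤ × ℤ → Prop)
    (hA : ∀ j x y, A j x → p x y ≠ 0 → A (j + 1) (x + y)) (hx : A 0 x) : A n u := by
  by_contra h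
  have := killedStep_pow_le (V := Set.univ) (f := Set.indicator {u} 1) (g := 0) hp A
    (fun j x y hj hy _ => hA j x y hj hy) n 0 x hx fun z hz => by
      have hzu : z ≠ u := by
        rintro rfl
        exact h (by simpa using hz)
      simp [hzu]
  simp only [map_zero, Pi.zero_apply] at this
  linarith

lemma trappedStates_inter_empty (hp : IsBoundedJumpLaw p D b) (hb : 0 ≤ b)
    (hG : ∀ x ∈ G, ∀ y, p x y ≠ 0 → x + y ∈ G)
    {k n : ℕ} (hk : 0 < k)
    (hell : ∀ x ∈ G,
      ∀ y ∈ ({((k : ℤ), (0 : ℤ)), (-(k : ℤ), 0), (0, (k : ℤ)), (0, -(k : ℤ))} : Set (ℤ × ℤ)),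
        0 < (killedStep p D Set.univ ^ n) (Set.indicator {x + y} 1) x)
    {α : ℝ} (hα0 : 0 < α) (hαπ : α ≤ Real.pi) {x : ℤ × ℤ} (hx : x ∈ G) :
    x ∉ trappedStates p D (Wset b α) := by
  intro hxN
  set N := {z | z ∈ G ∧ z ∈ trappedStates p D (Wset b α)} with hN
  have hNstep : ∀ z ∈ N, ∀ y, p z y ≠ 0 → z + y ∈ N := fun z hz y hy =>
    ⟨hG z hz.1 y hy, add_mem_trappedStates hp hz.2 hy⟩
  have hk1 : (1 : ℝ) ≤ k := by exact_mod_cast hk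
  have hleft : ∀ m : ℕ, x + (-(m * k : ℤ), 0) ∈ N := by
    intro m
    induction m with
    | zero =>
      convert And.intro hx hxN using 1
      simp [hN, Prod.mk_zero_zero]
    | succ m ih =>
      have h := mem_of_killedStep_univ_pow_pos hp (hell _ ih.1 (-(k : ℤ), 0) (by simp))
        (fun _ z => z ∈ N) (fun _ z y hz hy => hNstep z hz y hy) ih
      convert h using 1
      ext <;> simp
      ring
  rcases hαπ.lt_or_eq with hα | rfl
  · have hcos : -1 < Real.cos α := by
      rw [← Real.cos_pi]
      exact Real.cos_lt_cos_of_nonneg_of_le_pi hα0.le le_rfl hα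
    obtain ⟨m, hm⟩ := exists_nat_ge (|(x.1 : ℝ)| + |(x.2 : ℝ)| / (1 + Real.cos α))
    set z := x + (-(m * k : ℤ), 0) with hz
    have hz1 : (z.1 : ℝ) = x.1 - m * k := by simp [hz]; ring
    have hz2 : z.2 = x.2 := by simp [hz]
    have hmk : (m : ℝ) ≤ m * k := le_mul_of_one_le_right (by positivity) hk1
    have hzneg : |(x.2 : ℝ)| / (1 + Real.cos α) ≤ -z.1 := by
      rw [hz1]
      linarith [le_abs_self (x.1 : ℝ)]
    have hz0 : (z.1 : ℝ) ≤ 0 := by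
      have : 0 ≤ |(x.2 : ℝ)| / (1 + Real.cos α) := div_nonneg (abs_nonneg _) (by linarith)
      linarith
    rw [div_le_iff₀ (by linarith)] at hzneg
    have hzW : znorm z * Real.cos α < z.1 := by
      rcases (hleft m).2.1 with h | h
      · exact h.2
      · exact absurd h.1 hα.ne
    have hzn : znorm z ≤ -z.1 + |(x.2 : ℝ)| := by
      have h := Complex.norm_le_abs_re_add_abs_im (latticePoint z)
      rwa [norm_latticePoint, latticePoint_re, latticePoint_im, abs_of_nonpos hz0, hz2] at h
    have hr := znorm_nonneg z
    have h0 := abs_nonneg (x.2 : ℝ)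
    have hcneg : Real.cos α < 0 := by
      by_contra! hc
      have := mul_nonneg hr hc
      linarith
    have h1 := mul_le_mul_of_nonpos_right hzn hcneg.le
    nlinarith
  · have hNout : ∀ z ∈ N, (z.1 : ℝ) ≤ 0 → b < |(z.2 : ℝ)| := by
      intro z hz hz1
      rcases hz.2.1 with h | h
      · exact absurd h.1 (lt_irrefl _)
      · exact not_le.1 fun h' => h.2 ⟨hz1, h'⟩
    have hvert : ∀ s : ℤ, s = 1 ∨ s = -1 → ∀ z ∈ N, (z.1 : ℝ) ≤ -(n * b) → b < s * z.2 →
        z + (0, -(s * k)) ∈ N ∧ b < s * (z + (0, -(s * (k : ℤ)))).2 := by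
      intro s hs z hz hz1 hz2
      have hs' : (s : ℝ) = 1 ∨ (s : ℝ) = -1 := by
        rcases hs with rfl | rfl <;> simp
      have h := mem_of_killedStep_univ_pow_pos hp
        (hell z hz.1 (0, -(s * k)) (by rcases hs with rfl | rfl <;> simp))
        (fun j w => w ∈ N ∧ (j ≤ n → (w.1 : ℝ) ≤ -(n * b) + j * b ∧ b < s * w.2))
        (fun j w y hw hy => ⟨hNstep w hw.1 y hy, fun hj => ?_⟩)
        ⟨hz, fun _ => ⟨by simpa using hz1, hz2⟩⟩
      · exact ⟨h.1, (h.2 le_rfl).2⟩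
      · obtain ⟨hw1, hw2⟩ := hw.2 (by omega)
        have hyb := hp.znorm_le w y hy
        have hy1 := abs_le.1 ((abs_fst_le_znorm y).trans hyb)
        have hy2 := abs_le.1 ((abs_snd_le_znorm y).trans hyb)
        have e1 : ((w + y).1 : ℝ) ≤ -(n * b) + (j + 1 : ℕ) * b := by
          simp only [Prod.fst_add]
          push_cast
          linarith
        refine ⟨e1, ?_⟩
        have e2 : ((j + 1 : ℕ) : ℝ) * b ≤ n * b := by gcongr
        have e3 := hNout _ (hNstep w hw.1 y hy) (by linarith)
        simp only [Prod.snd_add] at e3 ⊢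
        push_cast at e3 ⊢
        rcases hs' with h | h <;> rw [h] at hw2 ⊢ <;> rcases lt_abs.1 e3 with h' | h' <;> linarith
    obtain ⟨m, hm⟩ := exists_nat_ge ((x.1 : ℝ) + n * b)
    set z := x + (-(m * k : ℤ), 0) with hz
    have hz1 : (z.1 : ℝ) ≤ -(n * b) := by
      have : (m : ℝ) ≤ m * k := le_mul_of_one_le_right (by positivity) hk1
      simp [hz]
      linarith
    obtain ⟨s, hs, hsz⟩ : ∃ s : ℤ, (s = 1 ∨ s = -1) ∧ b < s * z.2 := by
      rcases lt_abs.1 (hNout z (hleft m) (hz1.trans (by simp; positivity))) with h | h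
      · exact ⟨1, Or.inl rfl, by simpa using h⟩
      · exact ⟨-1, Or.inr rfl, by simpa using h⟩
    have hdown : ∀ i : ℕ, z + (0, -(i * (s * k))) ∈ N ∧
        b < s * (z + (0, -(i * (s * (k : ℤ))))).2 := by
      intro i
      induction i with
      | zero => simpa [Prod.mk_zero_zero] using And.intro (hleft m) hsz
      | succ i ih =>
        have h := hvert s hs _ ih.1 (by simpa using hz1) ih.2
        have e : z + (0, -(i * (s * (k : ℤ)))) + (0, -(s * (k : ℤ))) =
            z + (0, -((i + 1 : ℕ) * (s * (k : ℤ)))) := by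
          ext <;> simp
          ring
        rwa [e] at h
    have hfin := (hdown (s * z.2).toNat).2
    have hfin' : (0 : ℝ) < s * (z + (0, -((s * z.2).toNat * (s * (k : ℤ))))).2 := by linarith
    have hfin'' : 0 < s * (z + (0, -((s * z.2).toNat * (s * (k : ℤ))))).2 := by
      exact_mod_cast hfin'
    have hself := Int.self_le_toNat (s * z.2)
    have hk1' : (1 : ℤ) ≤ k := by exact_mod_cast hk
    have hss : s * s = 1 := by rcases hs with rfl | rfl <;> simp
    simp only [Prod.snd_add] at hfin''
    have e : s * (z.2 + -((s * z.2).toNat * (s * (k : ℤ)))) = s * z.2 - (s * z.2).toNat * k := by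
      linear_combination -((s * z.2).toNat * (k : ℤ)) * hss
    have hT := le_mul_of_one_le_right (Int.natCast_nonneg (s * z.2).toNat) hk1'
    linarith

lemma exists_killedStep_pow_one_lt (hp : IsBoundedJumpLaw p D b) (hb : 0 ≤ b)
    (hG : ∀ x ∈ G, ∀ y, p x y ≠ 0 → x + y ∈ G)
    {k n : ℕ} (hk : 0 < k)
    (hell : ∀ x ∈ G,
      ∀ y ∈ ({((k : ℤ), (0 : ℤ)), (-(k : ℤ), 0), (0, (k : ℤ)), (0, -(k : ℤ))} : Set (ℤ × ℤ)),
        0 < (killedStep p D Set.univ ^ n) (Set.indicator {x + y} 1) x)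
    {α : ℝ} (hα0 : 0 < α) (hαπ : α ≤ Real.pi) :
    ∀ x ∈ G ∩ Wset b α, ∃ m, (killedStep p D (Wset b α) ^ m) 1 x < 1 := by
  intro x hx
  by_contra! h
  exact trappedStates_inter_empty hp hb hG hk hell hα0 hαπ hx.1 ⟨hx.2, h⟩

end Exit

section Transfer

variable {Ω : Type*} [MeasurableSpace Ω] {P : Measure Ω} {ξ : ℕ → Ω → ℤ × ℤ}
  {p : ℤ × ℤ → ℤ × ℤ → ℝ} {D : Finset (ℤ × ℤ)} {b : ℝ}

/-- Multi-step Markov property for the walk observed inside `V` and ending in `Z`. -/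
lemma measure_inter_path_eq (hp : IsBoundedJumpLaw p D b) (hmeas : ∀ t, Measurable (ξ t))
    (hMarkov : IsMarkovWith P ξ p) (V Z : Set (ℤ × ℤ)) (n : ℕ) :
    ∀ (t : ℕ) (x : ℤ × ℤ) (A : Set Ω),
      MeasurableSet[⨆ s ∈ Finset.range (t + 1), MeasurableSpace.comap (ξ s) ⊤] A →
      P (A ∩ {ω | ξ t ω = x} ∩ {ω | (∀ s < n, ξ (t + s + 1) ω ∈ V) ∧ ξ (t + n) ω ∈ Z}) =
        ENNReal.ofReal ((killedStep p D V ^ n) (Z.indicator 1) x) * P (A ∩ {ω | ξ t ω = x}) := by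
  induction n with
  | zero =>
    intro t x A _
    by_cases hx : x ∈ Z
    · have : A ∩ {ω | ξ t ω = x} ∩ {ω | (∀ s < 0, ξ (t + s + 1) ω ∈ V) ∧ ξ (t + 0) ω ∈ Z} =
          A ∩ {ω | ξ t ω = x} := by
        refine Set.inter_eq_left.2 fun ω hω => ⟨by simp, ?_⟩
        have h : ξ t ω = x := hω.2
        simpa [h] using hx
      rw [this]
      simp [hx]
    · have : A ∩ {ω | ξ t ω = x} ∩ {ω | (∀ s < 0, ξ (t + s + 1) ω ∈ V) ∧ ξ (t + 0) ω ∈ Z} = ∅ := by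
        refine Set.eq_empty_of_forall_notMem ?_
        rintro ω ⟨⟨-, h⟩, -, h'⟩
        exact hx (h ▸ h')
      rw [this]
      simp [hx]
  | succ n ih =>
    intro t x A hA
    set B := A ∩ {ω | ξ t ω = x} with hB
    set E := {ω | (∀ s < n + 1, ξ (t + s + 1) ω ∈ V) ∧ ξ (t + (n + 1)) ω ∈ Z} with hE
    have hBmeas : MeasurableSet[⨆ s ∈ Finset.range (t + 1 + 1),
        MeasurableSpace.comap (ξ s) ⊤] B := by
      refine MeasurableSet.inter ?_ ?_
      · have hle : ⨆ s ∈ Finset.range (t + 1), MeasurableSpace.comap (ξ s) ⊤ ≤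
            ⨆ s ∈ Finset.range (t + 1 + 1), MeasurableSpace.comap (ξ s) ⊤ :=
          biSup_mono fun s hs => Finset.range_mono (Nat.le_succ _) hs
        exact hle A hA
      · exact le_biSup (fun s => MeasurableSpace.comap (ξ s) ⊤)
          (Finset.mem_range.2 (by omega : t < t + 1 + 1)) _ ⟨{x}, trivial, rfl⟩
    have hstep : ∀ y, P (B ∩ {ω | ξ (t + 1) ω = x + y}) = ENNReal.ofReal (p x y) * P B :=
      fun y => hMarkov t x y A hA
    have hnull : P (B ∩ {ω | ξ (t + 1) ω - x ∉ D}) = 0 := by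
      have hsub : B ∩ {ω | ξ (t + 1) ω - x ∉ D} ⊆
          ⋃ y ∈ {y | y ∉ D}, B ∩ {ω | ξ (t + 1) ω = x + y} := by
        rintro ω ⟨hω, hω'⟩
        exact Set.mem_iUnion₂.2 ⟨ξ (t + 1) ω - x, hω', hω, by simp⟩
      refine measure_mono_null hsub ((measure_biUnion_null_iff (Set.to_countable _)).2 ?_)
      intro y hy
      have : p x y = 0 := by
        by_contra h
        exact hy (hp.mem_of_ne_zero x y h)
      rw [hstep, this]
      simp
    have hjump : Measurable fun ω => ξ (t + 1) ω - x := (hmeas (t + 1)).sub_const x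
    have hsplit : P (B ∩ E) = ∑ y ∈ D, P ({ω | ξ (t + 1) ω = x + y} ∩ (B ∩ E)) := by
      have h := sum_measure_preimage_singleton (μ := P.restrict (B ∩ E)) D
        (f := fun ω => ξ (t + 1) ω - x) fun y _ => hjump (measurableSet_singleton y)
      rw [Measure.restrict_apply (hjump D.measurableSet)] at h
      have hD : P ((fun ω => ξ (t + 1) ω - x) ⁻¹' ↑D ∩ (B ∩ E)) = P (B ∩ E) := by
        refine le_antisymm (measure_mono Set.inter_subset_right) ?_
        refine (measure_mono (t := (fun ω => ξ (t + 1) ω - x) ⁻¹' ↑D ∩ (B ∩ E) ∪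
          B ∩ {ω | ξ (t + 1) ω - x ∉ D}) fun ω hω => ?_).trans
          ((measure_union_le _ _).trans (by rw [hnull, add_zero]))
        by_cases h : ξ (t + 1) ω - x ∈ D
        · exact Or.inl ⟨h, hω⟩
        · exact Or.inr ⟨hω.1, h⟩
      rw [← hD, ← h]
      refine Finset.sum_congr rfl fun y _ => ?_
      rw [Measure.restrict_apply (hjump (measurableSet_singleton y))]
      congr 2
      ext ω
      simp [sub_eq_iff_eq_add, add_comm]
    rw [hsplit, pow_succ', Module.End.mul_apply, killedStep_apply,
      ENNReal.ofReal_sum_of_nonneg, Finset.sum_mul]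
    · refine Finset.sum_congr rfl fun y _ => ?_
      rw [ENNReal.ofReal_mul (hp.nonneg x y)]
      by_cases hV : x + y ∈ V
      · rw [Set.indicator_of_mem hV, mul_right_comm, ← hstep, mul_comm, ← ih (t + 1) _ B hBmeas]
        congr 1
        ext ω
        simp only [hE, Set.mem_inter_iff, Set.mem_ofPred_eq]
        constructor
        · rintro ⟨h1, h2, h3, h4⟩
          refine ⟨⟨h2, h1⟩, fun s hs => ?_, ?_⟩
          · have := h3 (s + 1) (by omega)
            rwa [← add_assoc, add_right_comm t s 1] at this
          · rwa [add_assoc, add_comm 1 n]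
        · rintro ⟨⟨h2, h1⟩, h3, h4⟩
          refine ⟨h1, h2, fun s hs => ?_, ?_⟩
          · rcases s with _ | s
            · simpa [h1] using hV
            · have := h3 s (by omega)
              rwa [add_right_comm t 1 s, add_assoc t s 1] at this
          · rwa [add_assoc, add_comm 1 n] at h4
      · have : {ω | ξ (t + 1) ω = x + y} ∩ (B ∩ E) = ∅ := by
          refine Set.eq_empty_of_forall_notMem ?_
          rintro ω ⟨h, -, h', -⟩
          have := h' 0 (by omega)
          rw [Set.mem_ofPred_eq] at h
          rw [add_zero, h] at this
          exact hV this
        rw [this]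
        simp [hV]
    · intro y _
      refine mul_nonneg (hp.nonneg x y) (Set.indicator_nonneg (fun z _ => ?_) _)
      exact killedStep_pow_nonneg hp (Set.indicator_nonneg fun _ _ => zero_le_one) n z

/-- The states visited by the walk with positive probability. -/
def visitedStates (P : Measure Ω) (ξ : ℕ → Ω → ℤ × ℤ) : Set (ℤ × ℤ) :=
  {x | ∃ t, P {ω | ξ t ω = x} ≠ 0}

lemma visitedStates_subset {S : Set (ℤ × ℤ)} (hinS : ∀ t, ∀ᵐ ω ∂P, ξ t ω ∈ S) :
    visitedStates P ξ ⊆ S := by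
  rintro x ⟨t, ht⟩
  by_contra hx
  refine ht (measure_mono_null (fun ω hω => ?_) (ae_iff.1 (hinS t)))
  have h : ξ t ω = x := hω
  simpa [h] using hx

lemma add_mem_visitedStates (hMarkov : IsMarkovWith P ξ p) (hp : ∀ x y, 0 ≤ p x y) {x y : ℤ × ℤ}
    (hx : x ∈ visitedStates P ξ) (hy : p x y ≠ 0) : x + y ∈ visitedStates P ξ := by
  obtain ⟨t, ht⟩ := hx
  refine ⟨t + 1, fun h => ?_⟩
  have h1 := hMarkov t x y Set.univ MeasurableSet.univ
  rw [Set.univ_inter, measure_mono_null Set.inter_subset_right h, eq_comm, mul_eq_zero] at h1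
  rcases h1 with h1 | h1
  · exact hy (le_antisymm (ENNReal.ofReal_eq_zero.1 h1) (hp x y))
  · exact ht h1

lemma le_killedStep_univ_pow_of_A1 [IsFiniteMeasure P] (hp : IsBoundedJumpLaw p D b)
    (hmeas : ∀ t, Measurable (ξ t)) (hMarkov : IsMarkovWith P ξ p)
    {S : Set (ℤ × ℤ)} (hinS : ∀ t, ∀ᵐ ω ∂P, ξ t ω ∈ S) {κ : ℝ} {k n : ℕ}
    (hA1 : A1 P S ξ κ k n) {x : ℤ × ℤ} (hx : x ∈ visitedStates P ξ) {y : ℤ × ℤ}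
    (hy : y ∈ ({((k : ℤ), (0 : ℤ)), (-(k : ℤ), 0), (0, (k : ℤ)), (0, -(k : ℤ))} :
      Set (ℤ × ℤ))) :
    κ ≤ (killedStep p D Set.univ ^ n) (Set.indicator {x + y} 1) x := by
  have hxS := visitedStates_subset hinS hx
  obtain ⟨t, ht⟩ := hx
  have h := measure_inter_path_eq hp hmeas hMarkov Set.univ {x + y} n t x Set.univ
    MeasurableSet.univ
  simp only [Set.univ_inter, Set.mem_univ, implies_true, true_and, Set.mem_singleton_iff] at h
  have h1 := hA1 t x hxS y hy
  rw [h] at h1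
  have h2 := (ENNReal.mul_le_mul_iff_left ht (measure_ne_top P _)).1 h1
  refine (ENNReal.ofReal_le_ofReal_iff ?_).1 h2
  exact killedStep_pow_nonneg hp (Set.indicator_nonneg fun _ _ => zero_le_one) n x

lemma exists_isBoundedJumpLaw (hpmf : IsJumpPMF p) (hA2 : A2 p b) :
    ∃ D : Finset (ℤ × ℤ), IsBoundedJumpLaw p D b := by
  have hb : ∀ x y, p x y ≠ 0 → znorm y ≤ b := fun x y h => by
    by_contra! hlt
    exact h (hA2 x y hlt)
  have hD : ∀ x y, p x y ≠ 0 → y ∈ (finite_setOf_znorm_lt (b + 1)).toFinset := fun x y h => by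
    simpa using (hb x y h).trans_lt (lt_add_one b)
  refine ⟨_, hpmf.1, fun x => ?_, hD, hb⟩
  refine (hasSum_sum_of_ne_finset_zero fun y hy => ?_).unique (hpmf.2 x)
  by_contra h
  exact hy (hD x y h)

lemma IsBoundedJumpLaw.abs_sum_mul_le (hp : IsBoundedJumpLaw p D b) {f : ℤ × ℤ → ℝ}
    (hf : ∀ y, |f y| ≤ znorm y) (x : ℤ × ℤ) : |∑ y ∈ D, p x y * f y| ≤ b := by
  calc |∑ y ∈ D, p x y * f y| ≤ ∑ y ∈ D, |p x y * f y| := Finset.abs_sum_le_sum_abs _ _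
    _ ≤ ∑ y ∈ D, p x y * b := by
      refine Finset.sum_le_sum fun y _ => ?_
      rw [abs_mul, abs_of_nonneg (hp.nonneg x y)]
      by_cases h : p x y = 0
      · simp [h]
      · exact mul_le_mul_of_nonneg_left ((hf y).trans (hp.znorm_le x y h)) (hp.nonneg x y)
    _ = b := by rw [← Finset.sum_mul, hp.sum_eq_one, one_mul]

lemma IsBoundedJumpLaw.tsum_mul (hp : IsBoundedJumpLaw p D b) (f : ℤ × ℤ → ℝ) (x : ℤ × ℤ) :
    ∑' y, p x y * f y = ∑ y ∈ D, p x y * f y := by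
  refine tsum_eq_sum fun y hy => ?_
  have : p x y = 0 := by
    by_contra h
    exact hy (hp.mem_of_ne_zero x y h)
  rw [this, zero_mul]

/-- A quantity bounded near the origin and `O(1 / r)` at infinity is `O(1 / (1 + r))`. -/
lemma le_mul_inv_one_add {m b C r₀ r : ℝ} (hb : 0 ≤ b) (hC : 0 ≤ C) (hr₀ : 0 < r₀) (hr : 0 ≤ r)
    (hmb : m ≤ b) (hm : r₀ ≤ r → m ≤ C / r) :
    m ≤ (b * (1 + r₀) + C * (1 + r₀⁻¹)) * (1 + r)⁻¹ := by
  rw [← div_eq_mul_inv, le_div_iff₀ (by positivity)]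
  rcases le_total r₀ r with h | h
  · have hr' := hr₀.trans_le h
    have h1 := mul_le_mul_of_nonneg_right (hm h) (by positivity : 0 ≤ 1 + r)
    have h2 : C / r * (1 + r) = C * (1 + r⁻¹) := by field_simp; ring
    have h3 : C * (1 + r⁻¹) ≤ C * (1 + r₀⁻¹) := by gcongr
    have : 0 ≤ b * (1 + r₀) := by positivity
    linarith
  · have h1 := mul_le_mul_of_nonneg_right hmb (by positivity : 0 ≤ 1 + r)
    have h2 : b * (1 + r) ≤ b * (1 + r₀) := by gcongr
    have : 0 ≤ C * (1 + r₀⁻¹) := by positivity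
    linarith

end Transfer

/-- Theorem 2.1: under (A1), (A2) and drift `‖μ(x)‖ = O(‖x‖⁻¹)`,
for any `α ∈ (0,π]` and any `x ∈ W(α)`, `P[τ_α < ∞ ∣ ξ₀ = x] = 1`. -/
theorem exit_time_finite_as
    {Ω : Type*} [MeasurableSpace Ω] (P : Measure Ω) [IsProbabilityMeasure P]
    (S : Set (ℤ × ℤ)) (hSunb : ∀ R : ℝ, ∃ x ∈ S, R < znorm x)
    (ξ : ℕ → Ω → ℤ × ℤ) (hmeas : ∀ t, Measurable (ξ t))
    (hinS : ∀ t, ∀ᵐ ω ∂P, ξ t ω ∈ S)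
    (p : ℤ × ℤ → ℤ × ℤ → ℝ) (hpmf : IsJumpPMF p)
    (hMarkov : IsMarkovWith P ξ p)
    (κ : ℝ) (k n₀ : ℕ) (hκ : 0 < κ) (hk : 0 < k) (hn₀ : 0 < n₀)
    (hA1 : A1 P S ξ κ k n₀)
    (b : ℝ) (hb : 0 < b) (hA2 : A2 p b)
    (C r₀ : ℝ) (hC : 0 < C) (hr₀ : 0 < r₀)
    (hdrift : ∀ x ∈ S, r₀ ≤ znorm x → muNorm p x ≤ C / znorm x)
    (α : ℝ) (hα0 : 0 < α) (hαπ : α ≤ Real.pi) :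
    ∀ x ∈ Wset b α,
      P ({ω | ∃ t : ℕ, ξ t ω ∉ Wset b α} ∩ {ω | ξ 0 ω = x}) = P {ω | ξ 0 ω = x} := by
  intro x hx
  obtain ⟨D, hp⟩ := exists_isBoundedJumpLaw hpmf hA2
  refine le_antisymm (measure_mono Set.inter_subset_right) ?_
  by_cases hx0 : P {ω | ξ 0 ω = x} = 0
  · rw [hx0]
    exact zero_le
  have hG : ∀ z ∈ visitedStates P ξ, ∀ y, p z y ≠ 0 → z + y ∈ visitedStates P ξ :=
    fun z hz y hy => add_mem_visitedStates hMarkov hpmf.1 hz hy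
  have hell : ∀ z ∈ visitedStates P ξ,
      ∀ y ∈ ({((k : ℤ), (0 : ℤ)), (-(k : ℤ), 0), (0, (k : ℤ)), (0, -(k : ℤ))} : Set (ℤ × ℤ)),
        κ ≤ (killedStep p D Set.univ ^ n₀) (Set.indicator {z + y} 1) z :=
    fun z hz y hy => le_killedStep_univ_pow_of_A1 hp hmeas hMarkov hinS hA1 hz hy
  have hmu : ∀ z ∈ visitedStates P ξ, r₀ ≤ znorm z →
      |mu1 p z| ≤ C / znorm z ∧ |mu2 p z| ≤ C / znorm z := fun z hz hr =>
    have h := hdrift z (visitedStates_subset hinS hz) hr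
    ⟨(Real.abs_le_sqrt (le_add_of_nonneg_right (sq_nonneg _))).trans h,
      (Real.abs_le_sqrt (le_add_of_nonneg_left (sq_nonneg _))).trans h⟩
  obtain ⟨R₀, hR₀, hW⟩ := exists_forall_mem_Wset_not_strip b hα0
  have hlim := tendsto_killedStep_pow_one (c := b * (1 + r₀) + C * (1 + r₀⁻¹)) hp hb.le hG
    (by positivity)
    (fun z hz => le_mul_inv_one_add hb.le hC.le hr₀ (znorm_nonneg z)
      (hp.abs_sum_mul_le abs_fst_le_znorm z) fun hr => by
        rw [← hp.tsum_mul]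
        exact (hmu z hz hr).1)
    (fun z hz => le_mul_inv_one_add hb.le hC.le hr₀ (znorm_nonneg z)
      (hp.abs_sum_mul_le abs_snd_le_znorm z) fun hr => by
        rw [← hp.tsum_mul]
        exact (hmu z hz hr).2)
    hκ hk hn₀ (fun z hz => hell z hz _ (by simp)) (fun z hz => hell z hz _ (by simp)) hR₀ hW
    (exists_killedStep_pow_one_lt hp hb.le hG hk
      (fun z hz y hy => hκ.trans_le (hell z hz y hy)) hα0 hαπ) ⟨⟨0, hx0⟩, hx⟩
  have hstay : P ({ω | ξ 0 ω = x} ∩ {ω | ∀ t, ξ t ω ∈ Wset b α}) = 0 := by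
    have hle : ∀ m, P ({ω | ξ 0 ω = x} ∩ {ω | ∀ t, ξ t ω ∈ Wset b α}) ≤
        ENNReal.ofReal ((killedStep p D (Wset b α) ^ m) 1 x) := fun m => by
      have h := measure_inter_path_eq hp hmeas hMarkov (Wset b α) Set.univ m 0 x Set.univ
        MeasurableSet.univ
      rw [Set.univ_inter, Set.indicator_univ] at h
      refine (measure_mono ?_).trans (h.trans_le (mul_le_of_le_one_right' prob_le_one))
      exact Set.inter_subset_inter_right _ fun ω hω => ⟨fun s _ => hω _, Set.mem_univ _⟩
    have h0 := ENNReal.tendsto_ofReal hlim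
    rw [ENNReal.ofReal_zero] at h0
    exact le_antisymm (ge_of_tendsto' h0 hle) zero_le
  calc P {ω | ξ 0 ω = x}
      ≤ P ({ω | ∃ t : ℕ, ξ t ω ∉ Wset b α} ∩ {ω | ξ 0 ω = x} ∪
          {ω | ξ 0 ω = x} ∩ {ω | ∀ t, ξ t ω ∈ Wset b α}) := by
        refine measure_mono fun ω hω => ?_
        by_cases h : ∀ t, ξ t ω ∈ Wset b α
        · exact Or.inr ⟨hω, h⟩
        · exact Or.inl ⟨not_forall.1 h, hω⟩
    _ ≤ _ := (measure_union_le _ _).trans (by rw [hstay, add_zero])
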